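/- arXiv:1106.4251 — 3 statements merged into one kernel-verified Lean document; each statement's English description precedes it below -/
import Mathlib

section
/- Let p be an arbitrary probability distribution on [n]×[m], and suppose the loss ℓ is l-Lipschitz in its first argument and bounded by b (i.e. 0 ≤ ℓ(x,y) ≤ b for all x,y). Let X̂_S = argmin{L̂_S(X) : X ∈ W_p}. Then there is an absolute constant C such that, in expectation over a training sample S of size s drawn i.i.d. from p, E_S[L_p(X̂_S)] ≤ inf_{X ∈ W_p} L_p(X) + C·(l+b)·(r·n·log(n)/s)^{1/3}. -/
open scoped Classical
open Matrix Finset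

noncomputable section

/-- Trace norm (sum of singular values) of a real matrix. -/
def traceNorm {n m : ℕ} (X : Matrix (Fin n) (Fin m) ℝ) : ℝ :=
  ∑ j, Real.sqrt ((Matrix.isHermitian_conjTranspose_mul_self X).eigenvalues j)

/-- Weighted trace norm with row weights `pr` and column weights `pc`. -/
def wTrNorm {n m : ℕ} (pr : Fin n → ℝ) (pc : Fin m → ℝ)
    (X : Matrix (Fin n) (Fin m) ℝ) : ℝ :=
  traceNorm (Matrix.diagonal (fun i => Real.sqrt (pr i)) * X *
    Matrix.diagonal (fun j => Real.sqrt (pc j)))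

/-- Weighted trace-norm ball of radius `√r`. -/
def Wball {n m : ℕ} (pr : Fin n → ℝ) (pc : Fin m → ℝ) (r : ℝ) :
    Set (Matrix (Fin n) (Fin m) ℝ) :=
  {X | wTrNorm pr pc X ≤ Real.sqrt r}

/-- Row marginals of a distribution on `[n] × [m]`. -/
def rowMarg {n m : ℕ} (p : Matrix (Fin n) (Fin m) ℝ) (i : Fin n) : ℝ := ∑ j, p i j

/-- Column marginals of a distribution on `[n] × [m]`. -/
def colMarg {n m : ℕ} (p : Matrix (Fin n) (Fin m) ℝ) (j : Fin m) : ℝ := ∑ i, p i j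

/-- `p` is a probability distribution on `[n] × [m]`. -/
def IsDistrib {n m : ℕ} (p : Matrix (Fin n) (Fin m) ℝ) : Prop :=
  (∀ i j, 0 ≤ p i j) ∧ ∑ i, ∑ j, p i j = 1

/-- `ℓ` is `l`-Lipschitz in its first argument. -/
def LipLoss (l : ℝ) (ℓ : ℝ → ℝ → ℝ) : Prop :=
  ∀ x x' y, |ℓ x y - ℓ x' y| ≤ l * |x - x'|

/-- Probability of drawing the i.i.d. sample `S` from `p`. -/
def sampleProb {n m s : ℕ} (p : Matrix (Fin n) (Fin m) ℝ)
    (S : Fin s → Fin n × Fin m) : ℝ :=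
  ∏ t, p (S t).1 (S t).2

/-- Expectation over an i.i.d. sample of size `s` drawn from `p`. -/
def Esample {n m : ℕ} (s : ℕ) (p : Matrix (Fin n) (Fin m) ℝ)
    (f : (Fin s → Fin n × Fin m) → ℝ) : ℝ :=
  ∑ S : Fin s → Fin n × Fin m, sampleProb p S * f S

/-- Empirical risk of `X` on the sample `S` (target matrix `Y`, loss `ℓ`). -/
def empRisk {n m s : ℕ} (ℓ : ℝ → ℝ → ℝ) (Y : Matrix (Fin n) (Fin m) ℝ)
    (S : Fin s → Fin n × Fin m) (X : Matrix (Fin n) (Fin m) ℝ) : ℝ :=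
  (1 / (s : ℝ)) * ∑ t, ℓ (X (S t).1 (S t).2) (Y (S t).1 (S t).2)

/-- Population risk of `X` under sampling distribution `p`. -/
def popRisk {n m : ℕ} (p : Matrix (Fin n) (Fin m) ℝ) (ℓ : ℝ → ℝ → ℝ)
    (Y X : Matrix (Fin n) (Fin m) ℝ) : ℝ :=
  ∑ i, ∑ j, p i j * ℓ (X i j) (Y i j)


def sgn (b : Bool) : ℝ := if b then 1 else -1

theorem sgn_not (b : Bool) : sgn (!b) = - sgn b := by cases b <;> simp [sgn]
theorem sgn_sq (b : Bool) : sgn b * sgn b = 1 := by cases b <;> simp [sgn]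

/-- E over S -/
noncomputable def EX {α : Type*} [Fintype α] [DecidableEq α] (w : α → ℝ) (s : ℕ) (f : (Fin s → α) → ℝ) : ℝ :=
  ∑ S : Fin s → α, (∏ t, w (S t)) * f S

section
variable {α : Type*} [Fintype α] [DecidableEq α] {w : α → ℝ} {s : ℕ}

theorem EX_mono (hw : ∀ a, 0 ≤ w a) {f g : (Fin s → α) → ℝ} (h : ∀ S, f S ≤ g S) :
    EX w s f ≤ EX w s g :=
  Finset.sum_le_sum fun S _ => mul_le_mul_of_nonneg_left (h S) (Finset.prod_nonneg fun t _ => hw _)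

theorem EX_add (f g : (Fin s → α) → ℝ) :
    EX w s (fun S => f S + g S) = EX w s f + EX w s g := by
  simp [EX, mul_add, Finset.sum_add_distrib]

theorem EX_sub (f g : (Fin s → α) → ℝ) :
    EX w s (fun S => f S - g S) = EX w s f - EX w s g := by
  simp [EX, mul_sub, Finset.sum_sub_distrib]

theorem EX_const_mul (c : ℝ) (f : (Fin s → α) → ℝ) :
    EX w s (fun S => c * f S) = c * EX w s f := by
  simp only [EX, Finset.mul_sum]
  exact Finset.sum_congr rfl fun S _ => by ring

theorem EX_sum {κ : Type*} (K : Finset κ) (f : κ → (Fin s → α) → ℝ) :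
    EX w s (fun S => ∑ k ∈ K, f k S) = ∑ k ∈ K, EX w s (f k) := by
  simp only [EX, Finset.mul_sum]
  exact Finset.sum_comm

theorem EX_prod (g : Fin s → α → ℝ) :
    EX w s (fun S => ∏ t, g t (S t)) = ∏ t, ∑ a, w a * g t a := by
  simp only [EX, ← Finset.prod_mul_distrib]
  rw [Finset.prod_univ_sum, Fintype.piFinset_univ]

theorem EX_one (h1 : ∑ a, w a = 1) : EX w s (fun _ => 1) = 1 := by
  have := EX_prod (w := w) (s := s) (fun _ _ => 1)
  simpa [h1] using this

theorem EX_const (h1 : ∑ a, w a = 1) (c : ℝ) : EX w s (fun _ => c) = c := by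
  have := EX_const_mul (w := w) (s := s) c (fun _ => 1)
  rw [EX_one h1] at this
  simpa using this

theorem EX_eval (h1 : ∑ a, w a = 1) (t : Fin s) (f : α → ℝ) :
    EX w s (fun S => f (S t)) = ∑ a, w a * f a := by
  have := EX_prod (w := w) (s := s) (fun u a => if u = t then f a else 1)
  have e1 : ∀ S : Fin s → α, (∏ u, if u = t then f (S u) else 1) = f (S t) := by
    intro S; simp
  simp only [e1] at this
  rw [this, Finset.prod_eq_single t]
  · simp
  · intro u _ hu
    simp [hu, h1]
  · simp

theorem EX_evalsum (h1 : ∑ a, w a = 1) (f : α → ℝ) :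
    EX w s (fun S => ∑ t, f (S t)) = s * ∑ a, w a * f a := by
  rw [EX_sum]
  simp [EX_eval h1]

theorem iSup_add_le' {ι : Type*} [Fintype ι] [Nonempty ι] (f g : ι → ℝ) :
    (⨆ x, (f x + g x)) ≤ (⨆ x, f x) + ⨆ x, g x :=
  ciSup_le fun x => add_le_add (le_ciSup (Set.finite_range f).bddAbove x)
    (le_ciSup (Set.finite_range g).bddAbove x)

theorem iSup_EX_le (hw : ∀ a, 0 ≤ w a) {ι : Type*} [Fintype ι] [Nonempty ι]
    (f : ι → (Fin s → α) → ℝ) :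
    (⨆ x, EX w s (f x)) ≤ EX w s (fun S => ⨆ x, f x S) :=
  ciSup_le fun x => EX_mono hw fun S => le_ciSup (f := fun x => f x S) (Set.finite_range _).bddAbove x

/-- swap coordinates where the sign is negative -/
def swapE (ε : Fin s → Bool) : ((Fin s → α) × (Fin s → α)) ≃ ((Fin s → α) × (Fin s → α)) where
  toFun P := (fun t => if ε t then P.1 t else P.2 t, fun t => if ε t then P.2 t else P.1 t)
  invFun P := (fun t => if ε t then P.1 t else P.2 t, fun t => if ε t then P.2 t else P.1 t)
  left_inv P := by
    ext t <;> by_cases h : ε t <;> simp [h]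
  right_inv P := by
    ext t <;> by_cases h : ε t <;> simp [h]

theorem EX_swap (ε : Fin s → Bool) (G : (Fin s → α) → (Fin s → α) → ℝ) :
    EX w s (fun S => EX w s (fun S' => G S S')) =
    EX w s (fun S => EX w s (fun S' =>
      G (fun t => if ε t then S t else S' t) (fun t => if ε t then S' t else S t))) := by
  have key : ∀ H : (Fin s → α) → (Fin s → α) → ℝ,
      EX w s (fun S => EX w s (fun S' => H S S')) =
      ∑ P : (Fin s → α) × (Fin s → α), (∏ t, w (P.1 t) * w (P.2 t)) * H P.1 P.2 := by
    intro H
    simp only [EX, Fintype.sum_prod_type, Finset.mul_sum, Finset.prod_mul_distrib]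
    exact Finset.sum_congr rfl fun S _ => Finset.sum_congr rfl fun S' _ => by ring
  rw [key, key, ← (swapE ε).sum_comp]
  refine Finset.sum_congr rfl fun P _ => ?_
  congr 1
  refine Finset.prod_congr rfl fun t _ => ?_
  by_cases h : ε t <;> simp [swapE, h, mul_comm]

/-- average over signs -/
noncomputable def ES (s : ℕ) (f : (Fin s → Bool) → ℝ) : ℝ := EX (fun _ : Bool => (1/2 : ℝ)) s f

theorem ES_flip (f : (Fin s → Bool) → ℝ) : ES s (fun ε => f (fun t => !ε t)) = ES s f := by
  unfold ES EX
  let e : (Fin s → Bool) ≃ (Fin s → Bool) := Equiv.piCongrRight fun _ => Equiv.boolNot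
  rw [← e.sum_comp]
  simp [e]

theorem ES_flip_one (a : Fin s) (f : (Fin s → Bool) → ℝ) :
    ES s (fun ε => f (Function.update ε a (!ε a))) = ES s f := by
  unfold ES EX
  let e : (Fin s → Bool) ≃ (Fin s → Bool) :=
    { toFun := fun ε => Function.update ε a (!ε a)
      invFun := fun ε => Function.update ε a (!ε a)
      left_inv := fun ε => by simp
      right_inv := fun ε => by simp }
  rw [← e.sum_comp]
  simp [e]

theorem EX_comm {β : Type*} [Fintype β] [DecidableEq β] {v : β → ℝ} {k : ℕ}
    (G : (Fin s → α) → (Fin k → β) → ℝ) :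
    EX w s (fun S => EX v k (fun T => G S T)) = EX v k (fun T => EX w s (fun S => G S T)) := by
  simp only [EX, Finset.mul_sum]
  rw [Finset.sum_comm]
  exact Finset.sum_congr rfl fun S _ => Finset.sum_congr rfl fun S' _ => by ring

theorem half_sum : ∑ _b : Bool, (1/2 : ℝ) = 1 := by norm_num

theorem symmetrization (hw : ∀ a, 0 ≤ w a) (h1 : ∑ a, w a = 1) {ι : Type*} [Fintype ι] [Nonempty ι]
    (φ : ι → α → ℝ) :
    EX w s (fun S => ⨆ x, (s * ∑ a, w a * φ x a - ∑ t, φ x (S t))) ≤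
      2 * EX w s (fun S => ES s (fun ε => ⨆ x, ∑ t, sgn (ε t) * φ x (S t))) := by
  have step1 : EX w s (fun S => ⨆ x, (s * ∑ a, w a * φ x a - ∑ t, φ x (S t))) ≤
      EX w s (fun S => EX w s (fun S' => ⨆ x, (∑ t, φ x (S' t) - ∑ t, φ x (S t)))) := by
    refine EX_mono hw fun S => ?_
    refine le_trans (le_of_eq ?_) (iSup_EX_le hw _)
    congr 1; ext x
    rw [EX_sub, EX_evalsum h1, EX_const h1]
  have step2 : ∀ ε : Fin s → Bool,
      EX w s (fun S => EX w s (fun S' => ⨆ x, (∑ t, φ x (S' t) - ∑ t, φ x (S t)))) ≤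
      EX w s (fun S => ⨆ x, ∑ t, sgn (ε t) * φ x (S t)) +
      EX w s (fun S => ⨆ x, ∑ t, sgn (!ε t) * φ x (S t)) := by
    intro ε
    rw [EX_swap ε]
    have : EX w s (fun S => ⨆ x, ∑ t, sgn (ε t) * φ x (S t)) +
      EX w s (fun S => ⨆ x, ∑ t, sgn (!ε t) * φ x (S t)) =
      EX w s (fun S => EX w s (fun S' => (⨆ x, ∑ t, sgn (ε t) * φ x (S' t)) +
        ⨆ x, ∑ t, sgn (!ε t) * φ x (S t))) := by
      simp only [EX_add, EX_const h1]
    rw [this]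
    refine EX_mono hw fun S => EX_mono hw fun S' => ?_
    refine le_trans (le_of_eq ?_) (iSup_add_le' _ _)
    congr 1; ext x
    rw [← Finset.sum_sub_distrib, ← Finset.sum_add_distrib]
    refine Finset.sum_congr rfl fun t _ => ?_
    by_cases h : ε t <;> simp [h, sgn] <;> ring
  refine step1.trans ?_
  have : 2 * EX w s (fun S => ES s (fun ε => ⨆ x, ∑ t, sgn (ε t) * φ x (S t))) =
      ES s (fun ε => EX w s (fun S => ⨆ x, ∑ t, sgn (ε t) * φ x (S t)) +
      EX w s (fun S => ⨆ x, ∑ t, sgn (!ε t) * φ x (S t))) := by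
    unfold ES
    rw [EX_comm, EX_add, two_mul]
    congr 1
    exact (ES_flip (fun ε => EX w s (fun S => ⨆ x, ∑ t, sgn (ε t) * φ x (S t)))).symm
  rw [this, ← EX_const (s := s) half_sum (EX w s (fun S => EX w s (fun S' => ⨆ x, (∑ t, φ x (S' t) - ∑ t, φ x (S t)))))]
  exact EX_mono (fun _ => by norm_num) step2

theorem contraction_one {ι : Type*} [Fintype ι] [Nonempty ι] (h f g : ι → ℝ)
    (hfg : ∀ x y, |f x - f y| ≤ |g x - g y|) :
    (⨆ x, (h x + f x)) + (⨆ x, (h x - f x)) ≤ (⨆ x, (h x + g x)) + (⨆ x, (h x - g x)) := by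
  obtain ⟨x, hx⟩ := exists_eq_ciSup_of_finite (f := fun x => h x + f x)
  obtain ⟨y, hy⟩ := exists_eq_ciSup_of_finite (f := fun x => h x - f x)
  rw [← hx, ← hy]
  have b1 := fun x => le_ciSup (f := fun x => h x + g x) (Set.finite_range _).bddAbove x
  have b2 := fun x => le_ciSup (f := fun x => h x - g x) (Set.finite_range _).bddAbove x
  have := le_abs_self (f x - f y)
  have h2 := hfg x y
  have := b1 x; have := b1 y; have := b2 x; have := b2 y
  rcases abs_cases (g x - g y) with ⟨h3, _⟩ | ⟨h3, _⟩ <;> linarith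

theorem contraction {ι : Type*} [Fintype ι] [Nonempty ι] (f g : Fin s → ι → ℝ)
    (hfg : ∀ t x y, |f t x - f t y| ≤ |g t x - g t y|) :
    ES s (fun ε => ⨆ x, ∑ t, sgn (ε t) * f t x) ≤ ES s (fun ε => ⨆ x, ∑ t, sgn (ε t) * g t x) := by
  have main : ∀ A : Finset (Fin s),
      ES s (fun ε => ⨆ x, ∑ t, sgn (ε t) * f t x) ≤
      ES s (fun ε => ⨆ x, ∑ t, sgn (ε t) * (if t ∈ A then g t x else f t x)) := by
    intro A
    induction A using Finset.induction_on with
    | empty => simp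
    | insert a A ha ih =>
      refine ih.trans ?_
      have dbl : ∀ F : (Fin s → Bool) → ℝ,
          ES s F = (1/2) * ES s (fun ε => F ε + F (Function.update ε a (!ε a))) := by
        intro F
        have := ES_flip_one a F
        unfold ES at *
        rw [EX_add, this]; ring
      rw [dbl, dbl (fun ε => ⨆ x, ∑ t, sgn (ε t) * (if t ∈ insert a A then g t x else f t x))]
      refine mul_le_mul_of_nonneg_left (EX_mono (fun _ => by norm_num) fun ε => ?_) (by norm_num)
      have sp : ∀ (ε : Fin s → Bool) (u : Fin s → ι → ℝ) x, ∑ t, sgn (ε t) * u t x =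
          ∑ t ∈ univ.erase a, sgn (ε t) * u t x + sgn (ε a) * u a x := by
        intro ε u x
        rw [Finset.sum_erase_add _ _ (Finset.mem_univ a)]
      have := contraction_one
        (fun x => ∑ t ∈ univ.erase a, sgn (ε t) * (if t ∈ A then g t x else f t x))
        (fun x => sgn (ε a) * f a x) (fun x => sgn (ε a) * g a x) (by
          intro x y
          rw [← mul_sub, ← mul_sub, abs_mul, abs_mul]
          exact mul_le_mul_of_nonneg_left (hfg a x y) (abs_nonneg _))
      convert this using 3
      · ext x
        rw [sp ε (fun t x => if t ∈ A then g t x else f t x)]; simp [ha]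
      · ext x
        rw [sp _ (fun t x => if t ∈ A then g t x else f t x)]
        simp only [ha, Function.update_self, sgn_not, if_false]
        rw [sub_eq_add_neg, neg_mul]
        congr 1
        refine Finset.sum_congr rfl fun t ht => ?_
        rw [Function.update_of_ne (Finset.ne_of_mem_erase ht)]
      · ext x
        rw [sp ε (fun t x => if t ∈ insert a A then g t x else f t x)]
        simp only [Finset.mem_insert_self, if_true]
        congr 1
        refine Finset.sum_congr rfl fun t ht => ?_
        simp [Finset.mem_insert, Finset.ne_of_mem_erase ht]
      · ext x
        rw [sp _ (fun t x => if t ∈ insert a A then g t x else f t x)]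
        simp only [Finset.mem_insert_self, if_true, Function.update_self, sgn_not]
        rw [sub_eq_add_neg, neg_mul]
        congr 1
        refine Finset.sum_congr rfl fun t ht => ?_
        rw [Function.update_of_ne (Finset.ne_of_mem_erase ht)]
        simp [Finset.mem_insert, Finset.ne_of_mem_erase ht]
  simpa using main univ

end
theorem spec {d : Type*} [Fintype d] [DecidableEq d] (M : Matrix d d ℝ) (hM : Mᵀ = M) : ∃ (U : Matrix d d ℝ) (a : d → ℝ),
    Uᵀ * U = 1 ∧ U * Uᵀ = 1 ∧ ∀ k : ℕ, M ^ k = U * diagonal (fun i => a i ^ k) * Uᵀ := by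
  have hH : M.IsHermitian := by
    unfold Matrix.IsHermitian; rw [conjTranspose_eq_transpose_of_trivial]; exact hM
  have hs := hH.spectral_theorem
  rw [Unitary.conjStarAlgAut_apply] at hs
  have h1 := Unitary.coe_star_mul_self hH.eigenvectorUnitary
  have h2 := Unitary.coe_mul_star_self hH.eigenvectorUnitary
  rw [Unitary.coe_star] at h2
  rw [star_eq_conjTranspose, conjTranspose_eq_transpose_of_trivial] at h1 h2 hs
  generalize (hH.eigenvectorUnitary : Matrix d d ℝ) = U at *
  refine ⟨U, hH.eigenvalues, h1, h2, fun k => ?_⟩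
  have hs' : M = U * diagonal hH.eigenvalues * Uᵀ := hs
  generalize hH.eigenvalues = a at *
  induction k with
  | zero => simp [h2]
  | succ k ih =>
    rw [pow_succ, ih]
    have hm : U * diagonal (fun i => a i ^ k) * Uᵀ * M =
        U * diagonal (fun i => a i ^ k) * Uᵀ * (U * diagonal a * Uᵀ) := by rw [← hs']
    rw [hm]
    have : U * diagonal (fun i => a i ^ k) * Uᵀ * (U * diagonal a * Uᵀ) =
      U * (diagonal (fun i => a i ^ k) * (Uᵀ * U) * diagonal a) * Uᵀ := by
      simp only [Matrix.mul_assoc]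
    rw [this, h1, Matrix.mul_one, diagonal_mul_diagonal]
    simp [pow_succ]

theorem tr1 {d e : Type*} [Fintype d] [DecidableEq d] [Fintype e] (C G : Matrix d e ℝ) (f : d → ℝ) :
    trace (C * Gᵀ * diagonal f) = ∑ i, ∑ j, C i j * G i j * f i := by
  simp only [trace, diag_apply, mul_diagonal]
  simp [Matrix.mul_apply, Finset.sum_mul]

theorem tr2 {d e : Type*} [Fintype d] [Fintype e] [DecidableEq e] (C G : Matrix d e ℝ) (g : e → ℝ) :
    trace (Cᵀ * G * diagonal g) = ∑ i, ∑ j, C i j * G i j * g j := by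
  rw [Finset.sum_comm]
  simp only [trace, diag_apply, mul_diagonal]
  simp [Matrix.mul_apply, Finset.sum_mul]

theorem scalar_pair (x y : ℝ) (q r : ℕ) (h : Even (q + r)) :
    x ^ q * y ^ r + x ^ r * y ^ q ≤ x ^ (q + r) + y ^ (q + r) := by
  have hx : x ^ (q + r) = |x| ^ (q + r) := by rw [h.pow_abs]
  have hy : y ^ (q + r) = |y| ^ (q + r) := by rw [h.pow_abs]
  have a1 : x ^ q * y ^ r ≤ |x| ^ q * |y| ^ r := by
    rw [← abs_pow, ← abs_pow, ← abs_mul]; exact le_abs_self _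
  have a2 : x ^ r * y ^ q ≤ |x| ^ r * |y| ^ q := by
    rw [← abs_pow, ← abs_pow, ← abs_mul]; exact le_abs_self _
  rw [hx, hy]
  have hx0 := abs_nonneg x
  have hy0 := abs_nonneg y
  generalize |x| = u at *
  generalize |y| = v at *
  have key : 0 ≤ (u ^ q - v ^ q) * (u ^ r - v ^ r) := by
    rcases le_total u v with huv | huv
    · exact mul_nonneg_of_nonpos_of_nonpos
        (sub_nonpos.2 (pow_le_pow_left₀ hx0 huv _)) (sub_nonpos.2 (pow_le_pow_left₀ hx0 huv _))
    · exact mul_nonneg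
        (sub_nonneg.2 (pow_le_pow_left₀ hy0 huv _)) (sub_nonneg.2 (pow_le_pow_left₀ hy0 huv _))
  rw [pow_add, pow_add]
  nlinarith

theorem scalar_ineq (a b : ℝ) (k : ℕ) :
    (a - b) * (a ^ (2 * k + 1) - b ^ (2 * k + 1)) ≤
      (2 * k + 1) / 2 * ((a - b) ^ 2 * (a ^ (2 * k) + b ^ (2 * k))) := by
  have h1 := geom_sum₂_mul a b (2 * k + 1)
  have h2 : 2 * ∑ q ∈ Finset.range (2 * k + 1), a ^ q * b ^ (2 * k + 1 - 1 - q) ≤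
      (2 * k + 1) * (a ^ (2 * k) + b ^ (2 * k)) := by
    have hr := Finset.sum_range_reflect (fun q => a ^ q * b ^ (2 * k + 1 - 1 - q)) (2 * k + 1)
    rw [two_mul]
    nth_rewrite 1 [← hr]
    rw [← Finset.sum_add_distrib]
    have : (2 * k + 1 : ℝ) * (a ^ (2 * k) + b ^ (2 * k)) =
        ∑ q ∈ Finset.range (2 * k + 1), (a ^ (2 * k) + b ^ (2 * k)) := by
      rw [Finset.sum_const, nsmul_eq_mul]; simp
    rw [this]
    refine Finset.sum_le_sum fun q hq => ?_
    have hq' : q ≤ 2 * k := by simpa [Nat.lt_succ_iff] using hq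
    have e1 : 2 * k + 1 - 1 - (2 * k + 1 - 1 - q) = q := by omega
    have e2 : 2 * k + 1 - 1 - q = 2 * k - q := by omega
    rw [e1, e2]
    have := scalar_pair a b (2 * k - q) q (by rw [Nat.sub_add_cancel hq']; exact even_two_mul k)
    rwa [Nat.sub_add_cancel hq'] at this
  rw [← h1]
  have := mul_le_mul_of_nonneg_left h2 (sq_nonneg (a - b))
  nlinarith

theorem key_trace {d : Type*} [Fintype d] [DecidableEq d] (Y A : Matrix d d ℝ) (hY : Yᵀ = Y) (hA : Aᵀ = A)
    (k : ℕ) :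
    trace (A * (Y + A) ^ (2 * k + 1)) - trace (A * (Y - A) ^ (2 * k + 1)) ≤
      (2 * k + 1) * (trace (A * A * (Y + A) ^ (2 * k)) + trace (A * A * (Y - A) ^ (2 * k))) := by
  obtain ⟨U, a, hU1, hU2, hP⟩ := spec (Y + A) (by simp [hY, hA])
  obtain ⟨V, b, hV1, hV2, hQ⟩ := spec (Y - A) (by simp [hY, hA])
  set G := Uᵀ * V with hG
  set C := Uᵀ * A * V with hC
  have hCG : ∀ i j, 2 * C i j = (a i - b j) * G i j := by
    intro i j
    have e : (2 : ℝ) • A = (Y + A) ^ 1 - (Y - A) ^ 1 := by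
      rw [pow_one, pow_one, two_smul]; abel
    have e2 : (2 : ℝ) • C = diagonal a * G - G * diagonal b := by
      have : (2 : ℝ) • C = Uᵀ * ((2 : ℝ) • A) * V := by simp [hC]
      rw [this, e, hP, hQ, Matrix.mul_sub, Matrix.sub_mul]
      have e3 : Uᵀ * (U * diagonal (fun i => a i ^ 1) * Uᵀ) * V = (Uᵀ * U) * diagonal a * G := by
        simp only [pow_one, hG, Matrix.mul_assoc]
      have e4 : Uᵀ * (V * diagonal (fun i => b i ^ 1) * Vᵀ) * V = G * diagonal b * (Vᵀ * V) := by
        simp only [pow_one, hG, Matrix.mul_assoc]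
      rw [e3, e4, hU1, hV1, Matrix.one_mul, Matrix.mul_one]
    have := congrFun (congrFun e2 i) j
    simp [diagonal_mul, mul_diagonal] at this
    linarith
  have hCt : Cᵀ = Vᵀ * A * U := by simp [hC, hA, Matrix.mul_assoc]
  have hGt : Gᵀ = Vᵀ * U := by simp [hG]
  have t1 : ∀ f : d → ℝ, trace (A * (U * diagonal f * Uᵀ)) = ∑ i, ∑ j, C i j * G i j * f i := by
    intro f
    rw [← tr1, hGt, hC]
    have : Uᵀ * A * V * (Vᵀ * U) * diagonal f = Uᵀ * A * (V * Vᵀ) * U * diagonal f := by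
      simp only [Matrix.mul_assoc]
    rw [this, hV2, Matrix.mul_one]
    rw [← Matrix.mul_assoc, trace_mul_comm]
    simp only [Matrix.mul_assoc]
  have t2 : ∀ f : d → ℝ, trace (A * (V * diagonal f * Vᵀ)) = ∑ i, ∑ j, C i j * G i j * f j := by
    intro f
    rw [← tr2, hCt, hG]
    have : Vᵀ * A * U * (Uᵀ * V) * diagonal f = Vᵀ * A * (U * Uᵀ) * V * diagonal f := by
      simp only [Matrix.mul_assoc]
    rw [this, hU2, Matrix.mul_one]
    rw [← Matrix.mul_assoc, trace_mul_comm]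
    simp only [Matrix.mul_assoc]
  have t3 : ∀ f : d → ℝ, trace (A * A * (U * diagonal f * Uᵀ)) = ∑ i, ∑ j, C i j * C i j * f i := by
    intro f
    rw [← tr1, hCt, hC]
    have : Uᵀ * A * V * (Vᵀ * A * U) * diagonal f = Uᵀ * A * (V * Vᵀ) * A * U * diagonal f := by
      simp only [Matrix.mul_assoc]
    rw [this, hV2, Matrix.mul_one]
    rw [← Matrix.mul_assoc, trace_mul_comm]
    simp only [Matrix.mul_assoc]
  have t4 : ∀ f : d → ℝ, trace (A * A * (V * diagonal f * Vᵀ)) = ∑ i, ∑ j, C i j * C i j * f j := by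
    intro f
    rw [← tr2, hCt, hC]
    have : Vᵀ * A * U * (Uᵀ * A * V) * diagonal f = Vᵀ * A * (U * Uᵀ) * A * V * diagonal f := by
      simp only [Matrix.mul_assoc]
    rw [this, hU2, Matrix.mul_one]
    rw [← Matrix.mul_assoc, trace_mul_comm]
    simp only [Matrix.mul_assoc]
  rw [hP, hQ, hP, hQ, t1, t2, t3, t4]
  simp only [← Finset.sum_sub_distrib, ← Finset.sum_add_distrib, Finset.mul_sum]
  refine Finset.sum_le_sum fun i _ => Finset.sum_le_sum fun j _ => ?_
  have hc : C i j = (a i - b j) * G i j / 2 := by linarith [hCG i j]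
  have := mul_le_mul_of_nonneg_left (scalar_ineq (a i) (b j) k) (sq_nonneg (G i j))
  rw [hc]
  nlinarith

theorem sym_pow {d : Type*} [Fintype d] [DecidableEq d] (M : Matrix d d ℝ) (hM : Mᵀ = M) (k : ℕ) :
    (M ^ k)ᵀ = M ^ k := by rw [transpose_pow, hM]

theorem diag_pow_nonneg {d : Type*} [Fintype d] [DecidableEq d] (M : Matrix d d ℝ) (hM : Mᵀ = M) (k : ℕ) (i : d) :
    0 ≤ (M ^ (2 * k)) i i := by
  rw [two_mul, pow_add]
  nth_rewrite 2 [← sym_pow M hM k]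
  simp only [Matrix.mul_apply, transpose_apply]
  exact Finset.sum_nonneg fun j _ => mul_self_nonneg _

theorem trace_pow_nonneg {d : Type*} [Fintype d] [DecidableEq d] (M : Matrix d d ℝ) (hM : Mᵀ = M) (k : ℕ) :
    0 ≤ trace (M ^ (2 * k)) := Finset.sum_nonneg fun i _ => diag_pow_nonneg M hM k i

theorem opbound {d : Type*} [Fintype d] [DecidableEq d] (M : Matrix d d ℝ) (hM : Mᵀ = M) (k : ℕ) (hk : k ≠ 0)
    (L : ℝ) (h : trace (M ^ (2 * k)) ≤ L ^ (2 * k)) (x : d → ℝ) :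
    (M *ᵥ x) ⬝ᵥ (M *ᵥ x) ≤ L ^ 2 * (x ⬝ᵥ x) := by
  obtain ⟨U, a, hU1, hU2, hP⟩ := spec M hM
  have htr : ∀ j, trace (M ^ j) = ∑ i, a i ^ j := by
    intro j
    rw [hP, trace_mul_comm, ← Matrix.mul_assoc, hU1, Matrix.one_mul]
    simp [trace]
  have hai : ∀ i, a i ^ 2 ≤ L ^ 2 := by
    intro i
    have : a i ^ (2 * k) ≤ L ^ (2 * k) := by
      rw [htr] at h
      refine le_trans ?_ h
      refine Finset.single_le_sum (f := fun i => a i ^ (2 * k)) (fun j _ => ?_) (Finset.mem_univ i)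
      rw [pow_mul]; positivity
    rw [pow_mul, pow_mul] at this
    exact le_of_pow_le_pow_left₀ hk (by positivity) this
  have e1 : (M *ᵥ x) ⬝ᵥ (M *ᵥ x) = x ⬝ᵥ (M ^ 2 *ᵥ x) := by
    rw [pow_two, ← mulVec_mulVec, dotProduct_mulVec x, ← mulVec_transpose, hM]
  have e2 : ∀ f : d → ℝ, x ⬝ᵥ ((U * diagonal f * Uᵀ) *ᵥ x) = ∑ i, f i * (Uᵀ *ᵥ x) i ^ 2 := by
    intro f
    rw [← mulVec_mulVec, ← mulVec_mulVec, dotProduct_mulVec, ← mulVec_transpose]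
    simp only [dotProduct, mulVec_diagonal]
    exact Finset.sum_congr rfl fun i _ => by ring
  have e3 : x ⬝ᵥ x = ∑ i, (Uᵀ *ᵥ x) i ^ 2 := by
    have := e2 1
    simpa [hU2] using this
  rw [e1, hP, e2, e3, Finset.mul_sum]
  exact Finset.sum_le_sum fun i _ => mul_le_mul_of_nonneg_right (hai i) (sq_nonneg _)

theorem duality {n m : ℕ} (Q X : Matrix (Fin n) (Fin m) ℝ) (L : ℝ) (hL : 0 ≤ L)
    (h : ∀ x : Fin m → ℝ, (Q *ᵥ x) ⬝ᵥ (Q *ᵥ x) ≤ L ^ 2 * (x ⬝ᵥ x)) :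
    ∑ i, ∑ j, Q i j * X i j ≤ L * traceNorm X := by
  have hH := Matrix.isHermitian_conjTranspose_mul_self X
  unfold traceNorm
  have hs := hH.spectral_theorem
  rw [Unitary.conjStarAlgAut_apply] at hs
  have h1 := Unitary.coe_star_mul_self hH.eigenvectorUnitary
  have h2 := Unitary.coe_mul_star_self hH.eigenvectorUnitary
  rw [Unitary.coe_star] at h2
  rw [star_eq_conjTranspose] at h1 h2 hs
  generalize (hH.eigenvectorUnitary : Matrix (Fin m) (Fin m) ℝ) = U at *
  rw [conjTranspose_eq_transpose_of_trivial U] at h1 h2 hs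
  have hs' : Xᵀ * X = U * diagonal hH.eigenvalues * Uᵀ := by
    rw [← conjTranspose_eq_transpose_of_trivial X]; exact hs
  have e0 : ∑ i, ∑ j, Q i j * X i j = ∑ j, ∑ i, (Q * U) i j * (X * U) i j := by
    have a1 : ∀ Q X : Matrix (Fin n) (Fin m) ℝ, trace (Q * Xᵀ) = ∑ i, ∑ j, Q i j * X i j := by
      intro Q X
      simp [trace, Matrix.mul_apply]
    have a3 : ∑ j, ∑ i, (Q * U) i j * (X * U) i j = ∑ i, ∑ j, (Q * U) i j * (X * U) i j :=
      Finset.sum_comm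
    rw [a3, ← a1 Q X, ← a1 (Q * U) (X * U)]
    have : Q * U * (X * U)ᵀ = Q * (U * Uᵀ) * Xᵀ := by simp [Matrix.mul_assoc]
    rw [this, h2, Matrix.mul_one]
  have e1 : (X * U)ᵀ * (X * U) = diagonal hH.eigenvalues := by
    have : (X * U)ᵀ * (X * U) = Uᵀ * (Xᵀ * X) * U := by simp [Matrix.mul_assoc]
    rw [this, hs']
    have : Uᵀ * (U * diagonal hH.eigenvalues * Uᵀ) * U = (Uᵀ * U) * diagonal hH.eigenvalues * (Uᵀ * U) := by
      simp only [Matrix.mul_assoc]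
    rw [this, h1]; simp
  rw [e0, Finset.mul_sum]
  refine Finset.sum_le_sum fun j _ => ?_
  refine (Real.sum_mul_le_sqrt_mul_sqrt _ _ _).trans ?_
  refine mul_le_mul ?_ (le_of_eq ?_) (Real.sqrt_nonneg _) hL
  · rw [Real.sqrt_le_left hL]
    have := h (fun k => U k j)
    have u1 : (fun k => U k j) ⬝ᵥ (fun k => U k j) = 1 := by
      have := congrFun (congrFun h1 j) j
      simpa [Matrix.mul_apply, dotProduct] using this
    rw [u1, mul_one] at this
    refine le_trans (le_of_eq ?_) this
    simp only [dotProduct, mulVec, Matrix.mul_apply, pow_two]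
  · congr 1
    have := congrFun (congrFun e1 j) j
    rw [diagonal_apply_eq, Matrix.mul_apply] at this
    refine Eq.trans ?_ this
    simp only [transpose_apply, pow_two]
section
variable {d : Type*} [Fintype d] [DecidableEq d] {s : ℕ}

def radSum (A : Fin s → Matrix d d ℝ) (ε : Fin s → Bool) : Matrix d d ℝ := ∑ t, sgn (ε t) • A t

theorem radSum_sym (A : Fin s → Matrix d d ℝ) (hA : ∀ t, (A t)ᵀ = A t) (ε : Fin s → Bool) :
    (radSum A ε)ᵀ = radSum A ε := by
  simp [radSum, transpose_sum, hA]

theorem ES_mono {f g : (Fin s → Bool) → ℝ} (h : ∀ S, f S ≤ g S) : ES s f ≤ ES s g :=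
  EX_mono (fun _ => by norm_num) h

theorem nck_one (A : Fin s → Matrix d d ℝ) (hA : ∀ t, (A t)ᵀ = A t) (k : ℕ) (t : Fin s) :
    ES s (fun ε => sgn (ε t) * trace (A t * radSum A ε ^ (2 * k + 1))) ≤
      (2 * k + 1) * ES s (fun ε => trace (A t * A t * radSum A ε ^ (2 * k))) := by
  have dbl : ∀ F : (Fin s → Bool) → ℝ,
      ES s F = (1/2) * ES s (fun ε => F ε + F (Function.update ε t (!ε t))) := by
    intro F
    have := ES_flip_one t F
    unfold ES at *
    rw [EX_add, this]; ring
  rw [dbl, dbl (fun ε => trace (A t * A t * radSum A ε ^ (2 * k)))]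
  rw [mul_left_comm]
  refine mul_le_mul_of_nonneg_left ?_ (by norm_num)
  unfold ES
  rw [← EX_const_mul]
  refine ES_mono fun ε => ?_
  have sp : radSum A ε = ∑ u ∈ univ.erase t, sgn (ε u) • A u + sgn (ε t) • A t := by
    unfold radSum
    rw [Finset.sum_erase_add _ _ (Finset.mem_univ t)]
  have sp' : radSum A (Function.update ε t (!ε t)) =
      ∑ u ∈ univ.erase t, sgn (ε u) • A u - sgn (ε t) • A t := by
    unfold radSum
    rw [← Finset.sum_erase_add _ _ (Finset.mem_univ t), Function.update_self, sgn_not, neg_smul,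
      sub_eq_add_neg]
    congr 1
    refine Finset.sum_congr rfl fun u hu => ?_
    rw [Function.update_of_ne (Finset.ne_of_mem_erase hu)]
  have := key_trace (∑ u ∈ univ.erase t, sgn (ε u) • A u) (sgn (ε t) • A t)
    (by simp [transpose_sum, hA]) (by simp [hA]) k
  rw [← sp, ← sp'] at this
  simp only [smul_mul_assoc, mul_smul_comm, smul_smul, sgn_sq, one_smul, trace_smul, smul_eq_mul] at this
  simp only [Function.update_self, sgn_not]
  linarith

theorem nck_step (A : Fin s → Matrix d d ℝ) (hA : ∀ t, (A t)ᵀ = A t) (D : d → ℝ)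
    (hD : ∑ t, A t * A t = diagonal D) (v : ℝ) (hv : ∀ i, D i ≤ v) (k : ℕ) :
    ES s (fun ε => trace (radSum A ε ^ (2 * (k + 1)))) ≤
      (2 * k + 1) * v * ES s (fun ε => trace (radSum A ε ^ (2 * k))) := by
  have e1 : ∀ ε, trace (radSum A ε ^ (2 * (k + 1))) =
      ∑ t, sgn (ε t) * trace (A t * radSum A ε ^ (2 * k + 1)) := by
    intro ε
    have : 2 * (k + 1) = 1 + (2 * k + 1) := by ring
    rw [this, pow_add, pow_one]
    nth_rewrite 1 [radSum]
    simp [Finset.sum_mul, trace_sum, trace_smul]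
  simp only [e1]
  have : ES s (fun ε => ∑ t, sgn (ε t) * trace (A t * radSum A ε ^ (2 * k + 1))) =
    ∑ t, ES s (fun ε => sgn (ε t) * trace (A t * radSum A ε ^ (2 * k + 1))) := EX_sum _ _
  rw [this]
  refine (Finset.sum_le_sum fun t _ => nck_one A hA k t).trans ?_
  rw [← Finset.mul_sum, mul_assoc]
  refine mul_le_mul_of_nonneg_left ?_ (by positivity)
  unfold ES
  rw [← EX_sum, ← EX_const_mul]
  refine ES_mono fun ε => ?_
  rw [← trace_sum, ← Finset.sum_mul, hD]
  simp only [trace, diag_apply, diagonal_mul]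
  rw [Finset.mul_sum]
  exact Finset.sum_le_sum fun i _ => mul_le_mul_of_nonneg_right (hv i)
    (diag_pow_nonneg _ (radSum_sym A hA ε) k i)

theorem nck (A : Fin s → Matrix d d ℝ) (hA : ∀ t, (A t)ᵀ = A t) (D : d → ℝ)
    (hD : ∑ t, A t * A t = diagonal D) (v : ℝ) (hv0 : 0 ≤ v) (hv : ∀ i, D i ≤ v) (k j : ℕ) (hj : j ≤ k) :
    ES s (fun ε => trace (radSum A ε ^ (2 * j))) ≤ (2 * k * v) ^ j * Fintype.card d := by
  induction j with
  | zero =>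
    simp only [Nat.mul_zero, pow_zero, trace_one, one_mul]
    exact (EX_const half_sum _).le
  | succ j ih =>
    refine (nck_step A hA D hD v hv j).trans ?_
    have hjk : (2 * j + 1 : ℝ) ≤ 2 * k := by
      have : (j : ℝ) + 1 ≤ k := by exact_mod_cast hj
      linarith
    calc (2 * j + 1) * v * ES s (fun ε => trace (radSum A ε ^ (2 * j)))
        ≤ (2 * j + 1) * v * ((2 * k * v) ^ j * Fintype.card d) :=
          mul_le_mul_of_nonneg_left (ih (by omega)) (by positivity)
      _ ≤ (2 * k) * v * ((2 * k * v) ^ j * Fintype.card d) := by gcongr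
      _ = _ := by ring

theorem EX_pow_le {α : Type*} [Fintype α] [DecidableEq α] {w : α → ℝ} (hw : ∀ a, 0 ≤ w a)
    (h1 : ∑ a, w a = 1) (f : (Fin s → α) → ℝ) (hf : ∀ S, 0 ≤ f S) (k : ℕ) :
    (EX w s f) ^ k ≤ EX w s (fun S => f S ^ k) := by
  unfold EX
  refine Real.pow_arith_mean_le_arith_mean_pow _ _ _ (fun S _ => Finset.prod_nonneg fun t _ => hw _) ?_
    (fun S _ => hf S) k
  simpa [EX] using EX_one (s := s) h1

theorem nck_norm (A : Fin s → Matrix d d ℝ) (hA : ∀ t, (A t)ᵀ = A t) (D : d → ℝ)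
    (hD : ∑ t, A t * A t = diagonal D) (v : ℝ) (hv0 : 0 ≤ v) (hv : ∀ i, D i ≤ v) (k : ℕ) (hk : k ≠ 0)
    (hN : (Fintype.card d : ℝ) ≤ 3 ^ k) :
    ∃ L : (Fin s → Bool) → ℝ, (∀ ε, 0 ≤ L ε) ∧ (∀ ε, trace (radSum A ε ^ (2 * k)) ≤ L ε ^ (2 * k)) ∧
      ES s L ≤ Real.sqrt (6 * k * v) := by
  have h0 := fun ε => trace_pow_nonneg _ (radSum_sym A hA ε) k
  have e : ∀ ε, ((trace (radSum A ε ^ (2 * k))) ^ ((1 : ℝ) / (2 * k : ℕ))) ^ (2 * k) =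
      trace (radSum A ε ^ (2 * k)) := by
    intro ε
    rw [one_div]
    exact Real.rpow_inv_natCast_pow (h0 ε) (by omega)
  refine ⟨fun ε => (trace (radSum A ε ^ (2 * k))) ^ ((1 : ℝ) / (2 * k : ℕ)),
    fun ε => Real.rpow_nonneg (h0 ε) _, fun ε => (e ε).ge, ?_⟩
  refine le_of_pow_le_pow_left₀ (n := 2 * k) (by omega) (Real.sqrt_nonneg _) ?_
  refine (EX_pow_le (fun _ => by norm_num) half_sum _ (fun ε => Real.rpow_nonneg (h0 ε) _) _).trans ?_
  simp only [e]
  refine (nck A hA D hD v hv0 hv k k le_rfl).trans ?_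
  rw [pow_mul, Real.sq_sqrt (by positivity)]
  calc (2 * k * v) ^ k * (Fintype.card d : ℝ) ≤ (2 * k * v) ^ k * 3 ^ k := by gcongr
    _ = _ := by rw [← mul_pow]; ring
end

section
variable {n m s : ℕ}

def rowV (c : Fin n × Fin m → ℝ) (S : Fin s → Fin n × Fin m) (i : Fin n) : ℝ :=
  ∑ t, if (S t).1 = i then c (S t) ^ 2 else 0
def colV (c : Fin n × Fin m → ℝ) (S : Fin s → Fin n × Fin m) (j : Fin m) : ℝ :=
  ∑ t, if (S t).2 = j then c (S t) ^ 2 else 0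

theorem cond_rad (c : Fin n × Fin m → ℝ) (S : Fin s → Fin n × Fin m) (v : ℝ) (hv0 : 0 ≤ v)
    (hr : ∀ i, rowV c S i ≤ v) (hc : ∀ j, colV c S j ≤ v) (k : ℕ) (hk : k ≠ 0)
    (hN : (n : ℝ) + m ≤ 3 ^ k) {ι : Type*} [Fintype ι] [Nonempty ι]
    (X : ι → Matrix (Fin n) (Fin m) ℝ) (R : ℝ) (hX : ∀ x, traceNorm (X x) ≤ R) :
    ES s (fun ε => ⨆ x, ∑ t, sgn (ε t) * (c (S t) * X x (S t).1 (S t).2)) ≤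
      R * Real.sqrt (6 * k * v) := by
  set E : Fin s → Matrix (Fin n) (Fin m) ℝ := fun t => Matrix.single (S t).1 (S t).2 (c (S t)) with hE
  set A : Fin s → Matrix (Fin n ⊕ Fin m) (Fin n ⊕ Fin m) ℝ :=
    fun t => fromBlocks 0 (E t) (E t)ᵀ 0 with hA
  have hAs : ∀ t, (A t)ᵀ = A t := by
    intro t; simp [hA, fromBlocks_transpose]
  have hD : ∑ t, A t * A t = diagonal (Sum.elim (rowV c S) (colV c S)) := by
    have h1 : ∀ t, A t * A t = diagonal (Sum.elim (fun i => if (S t).1 = i then c (S t) ^ 2 else 0)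
        (fun j => if (S t).2 = j then c (S t) ^ 2 else 0)) := by
      intro t
      simp only [hA, hE, fromBlocks_multiply]
      ext (i | i) (j | j) <;>
        simp [diagonal_apply, Matrix.single_apply, pow_two]
      · by_cases h : i = j
        · subst h; simp
        · simp [h]; intro h1 h2; exact absurd (h1.symm.trans h2) h
      · by_cases h : i = j
        · subst h; simp
        · simp [h]; intro h1 h2; exact absurd (h1.symm.trans h2) h
    simp only [h1]
    ext i j
    by_cases h : i = j
    · subst h
      rcases i with i | i <;> simp [Matrix.sum_apply, rowV, colV]
    · simp [Matrix.sum_apply, h]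
  obtain ⟨L, hL0, hL1, hL2⟩ := nck_norm A hAs _ hD v hv0 (by
    rintro (i | i)
    · exact hr i
    · exact hc i) k hk (by simpa using hN)
  have hR : 0 ≤ R := by
    obtain ⟨x⟩ := ‹Nonempty ι›
    exact le_trans (Finset.sum_nonneg fun _ _ => Real.sqrt_nonneg _) (hX x)
  calc ES s (fun ε => ⨆ x, ∑ t, sgn (ε t) * (c (S t) * X x (S t).1 (S t).2))
      ≤ ES s (fun ε => R * L ε) := by
        refine ES_mono fun ε => ciSup_le fun x => ?_
        set Q : Matrix (Fin n) (Fin m) ℝ := ∑ t, sgn (ε t) • E t with hQ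
        have hrad : radSum A ε = fromBlocks 0 Q Qᵀ 0 := by
          ext (i | i) (j | j) <;> simp [radSum, hA, hQ, Matrix.sum_apply]
        have hb : ∀ y : Fin m → ℝ, (Q *ᵥ y) ⬝ᵥ (Q *ᵥ y) ≤ L ε ^ 2 * (y ⬝ᵥ y) := by
          intro y
          have := opbound (radSum A ε) (radSum_sym A hAs ε) k hk (L ε) (hL1 ε) (Sum.elim 0 y)
          rw [hrad, fromBlocks_mulVec] at this
          simpa using this
        have hd := duality Q (X x) (L ε) (hL0 ε) hb
        have e : ∑ t, sgn (ε t) * (c (S t) * X x (S t).1 (S t).2) = ∑ i, ∑ j, Q i j * X x i j := by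
          simp only [hQ, Matrix.sum_apply, Finset.sum_mul, Matrix.smul_apply, hE, smul_eq_mul]
          have : ∀ i, ∑ j, ∑ t, sgn (ε t) * Matrix.single (S t).1 (S t).2 (c (S t)) i j * X x i j =
            ∑ t, ∑ j, sgn (ε t) * Matrix.single (S t).1 (S t).2 (c (S t)) i j * X x i j :=
            fun i => Finset.sum_comm
          simp only [this]
          rw [Finset.sum_comm]
          refine Finset.sum_congr rfl fun t _ => ?_
          rw [Finset.sum_eq_single (S t).1, Finset.sum_eq_single (S t).2]
          · simp [mul_assoc]
          · intro j _ hj; simp [Matrix.single_apply, hj.symm]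
          · simp
          · intro i _ hi; simp [Matrix.single_apply, hi.symm]
          · simp
        rw [e]
        refine hd.trans ?_
        rw [mul_comm]
        exact mul_le_mul_of_nonneg_right (hX x) (hL0 ε)
    _ = R * ES s L := EX_const_mul _ _
    _ ≤ _ := mul_le_mul_of_nonneg_left hL2 hR
end
theorem exp_max {α : Type*} [Fintype α] [DecidableEq α] {w : α → ℝ} {s : ℕ} (hw : ∀ a, 0 ≤ w a)
    (h1 : ∑ a, w a = 1) {κ : Type*} [Fintype κ] [Nonempty κ] (g : κ → α → ℝ) (M μ : ℝ) (hM : 0 < M)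
    (hg0 : ∀ k a, 0 ≤ g k a) (hgM : ∀ k a, g k a ≤ M) (hμ : ∀ k, ∑ a, w a * g k a ≤ μ) :
    EX w s (fun S => ⨆ k, ∑ t, g k (S t)) ≤ M * Real.log (Fintype.card κ) + 2 * s * μ := by
  have hcard : (0 : ℝ) < Fintype.card κ := by exact_mod_cast Fintype.card_pos
  set B : ℝ := Fintype.card κ * Real.exp (2 * s * μ / M) with hB
  have hB0 : 0 < B := by positivity
  have e1 : ∀ k, EX w s (fun S => Real.exp ((∑ t, g k (S t)) / M)) ≤ Real.exp (2 * s * μ / M) := by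
    intro k
    have : ∀ S : Fin s → α, Real.exp ((∑ t, g k (S t)) / M) = ∏ t, Real.exp (g k (S t) / M) := by
      intro S; rw [Finset.sum_div, Real.exp_sum]
    simp only [this]
    rw [EX_prod (fun _ a => Real.exp (g k a / M))]
    have hle : ∑ a, w a * Real.exp (g k a / M) ≤ Real.exp (2 * μ / M) := by
      calc ∑ a, w a * Real.exp (g k a / M) ≤ ∑ a, w a * (1 + 2 * (g k a / M)) := by
            refine Finset.sum_le_sum fun a _ => mul_le_mul_of_nonneg_left ?_ (hw a)
            have hx0 : 0 ≤ g k a / M := div_nonneg (hg0 k a) hM.le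
            have hx1 : g k a / M ≤ 1 := (div_le_one hM).2 (hgM k a)
            have := Real.abs_exp_sub_one_le (x := g k a / M) (by rwa [abs_of_nonneg hx0])
            rw [abs_of_nonneg hx0] at this
            linarith [le_abs_self (Real.exp (g k a / M) - 1)]
        _ = 1 + 2 / M * ∑ a, w a * g k a := by
            simp only [mul_add, mul_one, Finset.sum_add_distrib, h1, Finset.mul_sum]
            congr 1
            exact Finset.sum_congr rfl fun a _ => by ring
        _ ≤ 1 + 2 / M * μ := by
            have := mul_le_mul_of_nonneg_left (hμ k) (by positivity : 0 ≤ 2 / M)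
            linarith
        _ ≤ _ := by
            have := Real.add_one_le_exp (2 * μ / M)
            have e : 2 / M * μ = 2 * μ / M := by ring
            linarith
    calc ∏ _t : Fin s, ∑ a, w a * Real.exp (g k a / M) ≤ ∏ _t : Fin s, Real.exp (2 * μ / M) :=
          Finset.prod_le_prod (fun _ _ => Finset.sum_nonneg fun a _ => mul_nonneg (hw a) (Real.exp_pos _).le)
            (fun _ _ => hle)
      _ = _ := by
          rw [Finset.prod_const, ← Real.exp_nat_mul]; simp; ring
  have e2 : ∀ S : Fin s → α, (⨆ k, ∑ t, g k (S t)) ≤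
      M * (Real.log B - 1) + M / B * ∑ k, Real.exp ((∑ t, g k (S t)) / M) := by
    intro S
    refine ciSup_le fun k => ?_
    have a1 : Real.exp ((∑ t, g k (S t)) / M) ≤ ∑ k, Real.exp ((∑ t, g k (S t)) / M) :=
      Finset.single_le_sum (f := fun k => Real.exp ((∑ t, g k (S t)) / M))
        (fun _ _ => (Real.exp_pos _).le) (Finset.mem_univ k)
    have a2 := Real.add_one_le_exp ((∑ t, g k (S t)) / M - Real.log B)
    rw [Real.exp_sub, Real.exp_log hB0] at a2
    have a3 := mul_le_mul_of_nonneg_left a2 hM.le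
    have a4 := mul_le_mul_of_nonneg_left a1 (by positivity : 0 ≤ M / B)
    have a5 : M * ((∑ t, g k (S t)) / M) = ∑ t, g k (S t) := by field_simp
    have a6 : M * (Real.exp ((∑ t, g k (S t)) / M) / B) = M / B * Real.exp ((∑ t, g k (S t)) / M) := by ring
    rw [a6] at a3
    nlinarith
  refine (EX_mono hw e2).trans ?_
  rw [EX_add, EX_const h1, EX_const_mul, EX_sum]
  have e3 : ∑ k, EX w s (fun S => Real.exp ((∑ t, g k (S t)) / M)) ≤ B := by
    refine (Finset.sum_le_sum fun k _ => e1 k).trans ?_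
    simp [hB]
  have e4 := mul_le_mul_of_nonneg_left e3 (by positivity : 0 ≤ M / B)
  have e5 : M / B * B = M := by field_simp
  have e6 : M * Real.log B = M * Real.log (Fintype.card κ) + 2 * s * μ := by
    rw [hB, Real.log_mul hcard.ne' (Real.exp_pos _).ne', Real.log_exp]
    field_simp
  nlinarith

section
variable {n m s : ℕ}

def heavy (p : Matrix (Fin n) (Fin m) ℝ) (τ : ℝ) (a : Fin n × Fin m) : Prop :=
  τ ≤ rowMarg p a.1 ∧ τ ≤ colMarg p a.2

def hind (p : Matrix (Fin n) (Fin m) ℝ) (τ : ℝ) (a : Fin n × Fin m) : ℝ :=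
  if heavy p τ a then 1 else 0

def cwt (p : Matrix (Fin n) (Fin m) ℝ) (τ : ℝ) (a : Fin n × Fin m) : ℝ :=
  if heavy p τ a then 1 / (Real.sqrt (rowMarg p a.1) * Real.sqrt (colMarg p a.2)) else 0

def pw (p : Matrix (Fin n) (Fin m) ℝ) (a : Fin n × Fin m) : ℝ := p a.1 a.2

theorem cwt_sq (p : Matrix (Fin n) (Fin m) ℝ) (τ : ℝ) (hτ : 0 < τ) (a : Fin n × Fin m) :
    cwt p τ a ^ 2 = if heavy p τ a then 1 / (rowMarg p a.1 * colMarg p a.2) else 0 := by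
  unfold cwt
  split_ifs with h
  · rw [div_pow, mul_pow, Real.sq_sqrt (hτ.le.trans h.1), Real.sq_sqrt (hτ.le.trans h.2), one_pow]
  · simp

theorem cwt_sq_le (p : Matrix (Fin n) (Fin m) ℝ) (τ : ℝ) (hτ : 0 < τ) (a : Fin n × Fin m) :
    cwt p τ a ^ 2 ≤ 1 / τ ^ 2 := by
  rw [cwt_sq p τ hτ]
  split_ifs with h
  · rw [pow_two]
    exact one_div_le_one_div_of_le (by positivity) (mul_le_mul h.1 h.2 hτ.le (hτ.le.trans h.1))
  · positivity

theorem row_mean (p : Matrix (Fin n) (Fin m) ℝ) (hp : ∀ i j, 0 ≤ p i j) (τ : ℝ) (hτ : 0 < τ) (i : Fin n) :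
    ∑ a : Fin n × Fin m, pw p a * (if a.1 = i then cwt p τ a ^ 2 else 0) ≤ 1 / τ := by
  rw [Fintype.sum_prod_type, Finset.sum_eq_single i]
  · simp only [if_true, pw]
    by_cases hi : τ ≤ rowMarg p i
    · have h0 : 0 < rowMarg p i := hτ.trans_le hi
      calc ∑ j, p i j * cwt p τ (i, j) ^ 2 ≤ ∑ j, p i j * (1 / (rowMarg p i * τ)) := by
            refine Finset.sum_le_sum fun j _ => mul_le_mul_of_nonneg_left ?_ (hp i j)
            rw [cwt_sq p τ hτ]
            split_ifs with h
            · exact one_div_le_one_div_of_le (by positivity) (mul_le_mul_of_nonneg_left h.2 h0.le)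
            · positivity
        _ = rowMarg p i * (1 / (rowMarg p i * τ)) := by rw [← Finset.sum_mul]; rfl
        _ = 1 / τ := by field_simp
        _ ≤ _ := le_rfl
    · have : ∀ j, cwt p τ (i, j) = 0 := by
        intro j; unfold cwt; rw [if_neg]; exact fun h => hi h.1
      simp [this]; exact hτ.le
  · intro k _ hk; simp [hk]
  · simp

theorem col_mean (p : Matrix (Fin n) (Fin m) ℝ) (hp : ∀ i j, 0 ≤ p i j) (τ : ℝ) (hτ : 0 < τ) (j : Fin m) :
    ∑ a : Fin n × Fin m, pw p a * (if a.2 = j then cwt p τ a ^ 2 else 0) ≤ 1 / τ := by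
  rw [Fintype.sum_prod_type_right, Finset.sum_eq_single j]
  · simp only [if_true, pw]
    by_cases hi : τ ≤ colMarg p j
    · have h0 : 0 < colMarg p j := hτ.trans_le hi
      calc ∑ i, p i j * cwt p τ (i, j) ^ 2 ≤ ∑ i, p i j * (1 / (τ * colMarg p j)) := by
            refine Finset.sum_le_sum fun i _ => mul_le_mul_of_nonneg_left ?_ (hp i j)
            rw [cwt_sq p τ hτ]
            split_ifs with h
            · exact one_div_le_one_div_of_le (by positivity) (mul_le_mul_of_nonneg_right h.1 h0.le)
            · positivity
        _ = colMarg p j * (1 / (τ * colMarg p j)) := by rw [← Finset.sum_mul]; rfl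
        _ = 1 / τ := by field_simp
        _ ≤ _ := le_rfl
    · have : ∀ i, cwt p τ (i, j) = 0 := by
        intro i; unfold cwt; rw [if_neg]; exact fun h => hi h.2
      simp [this]; exact hτ.le
  · intro k _ hk; simp [hk]
  · simp

theorem pw_sum (p : Matrix (Fin n) (Fin m) ℝ) (hp : IsDistrib p) : ∑ a, pw p a = 1 := by
  rw [Fintype.sum_prod_type]; exact hp.2

theorem light_prob (p : Matrix (Fin n) (Fin m) ℝ) (hp : IsDistrib p) (τ : ℝ) (hτ : 0 < τ) :
    ∑ a, pw p a * (1 - hind p τ a) ≤ (n + m) * τ := by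
  have h1 : ∀ a, pw p a * (1 - hind p τ a) ≤
      (if rowMarg p a.1 < τ then pw p a else 0) + (if colMarg p a.2 < τ then pw p a else 0) := by
    intro a
    have h0 : 0 ≤ pw p a := hp.1 _ _
    unfold hind heavy
    by_cases hr : τ ≤ rowMarg p a.1 <;> by_cases hc : τ ≤ colMarg p a.2
    · simp [hr, hc, not_lt.2 hr, not_lt.2 hc]
    · simp [hr, hc, not_lt.2 hr, not_le.1 hc]
    · simp [hr, hc, not_le.1 hr, not_lt.2 hc]
    · simp [hr, hc, not_le.1 hr, not_le.1 hc, h0]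
  refine (Finset.sum_le_sum fun a _ => h1 a).trans ?_
  rw [Finset.sum_add_distrib, add_mul]
  refine add_le_add ?_ ?_
  · rw [Fintype.sum_prod_type]
    calc ∑ i, ∑ j, (if rowMarg p i < τ then pw p (i, j) else 0) ≤ ∑ i : Fin n, τ := by
          refine Finset.sum_le_sum fun i _ => ?_
          by_cases h : rowMarg p i < τ
          · simp only [h, if_true]; exact h.le
          · simp [h, hτ.le]
      _ = _ := by simp
  · rw [Fintype.sum_prod_type_right]
    calc ∑ j, ∑ i, (if colMarg p j < τ then pw p (i, j) else 0) ≤ ∑ i : Fin m, τ := by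
          refine Finset.sum_le_sum fun i _ => ?_
          by_cases h : colMarg p i < τ
          · simp only [h, if_true]; exact h.le
          · simp [h, hτ.le]
      _ = _ := by simp

theorem rad_bound (p : Matrix (Fin n) (Fin m) ℝ) (hp : IsDistrib p) (τ : ℝ) (hτ : 0 < τ) (r : ℝ)
    (hn : 0 < n) (k : ℕ) (hk : k ≠ 0) (hN : (n : ℝ) + m ≤ 3 ^ k)
    {ι : Type*} [Fintype ι] [Nonempty ι] (X : ι → Matrix (Fin n) (Fin m) ℝ)
    (hX : ∀ x, X x ∈ Wball (rowMarg p) (colMarg p) r) :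
    EX (pw p) s (fun S => ES s (fun ε => ⨆ x, ∑ t, sgn (ε t) * (hind p τ (S t) * X x (S t).1 (S t).2))) ≤
      Real.sqrt r * Real.sqrt (6 * k * (1 / τ ^ 2 * Real.log (n + m) + 2 * s * (1 / τ))) := by
  have : Nonempty (Fin n ⊕ Fin m) := ⟨Sum.inl ⟨0, hn⟩⟩
  have hw : ∀ a, 0 ≤ pw p a := fun a => hp.1 _ _
  have h1 := pw_sum p hp
  set g : (Fin n ⊕ Fin m) → Fin n × Fin m → ℝ := Sum.elim
    (fun i a => if a.1 = i then cwt p τ a ^ 2 else 0)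
    (fun j a => if a.2 = j then cwt p τ a ^ 2 else 0) with hg
  set v : (Fin s → Fin n × Fin m) → ℝ := fun S => ⨆ k, ∑ t, g k (S t) with hv
  have hg0 : ∀ k a, 0 ≤ g k a := by
    rintro (i | j) a <;> simp only [hg, Sum.elim_inl, Sum.elim_inr] <;> split_ifs <;> positivity
  have hle : ∀ S k, ∑ t, g k (S t) ≤ v S := fun S k =>
    le_ciSup (f := fun k => ∑ t, g k (S t)) (Set.finite_range _).bddAbove k
  have hv0 : ∀ S, 0 ≤ v S := fun S =>
    le_trans (Finset.sum_nonneg fun t _ => hg0 (Sum.inl ⟨0, hn⟩) (S t)) (hle S _)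
  have hEv : EX (pw p) s v ≤ 1 / τ ^ 2 * Real.log (n + m) + 2 * s * (1 / τ) := by
    have := exp_max (s := s) hw h1 g (1 / τ ^ 2) (1 / τ) (by positivity) hg0 (by
      rintro (i | j) a <;> simp only [hg, Sum.elim_inl, Sum.elim_inr] <;> split_ifs
      · exact cwt_sq_le p τ hτ a
      · positivity
      · exact cwt_sq_le p τ hτ a
      · positivity) (by
      rintro (i | j)
      · exact row_mean p hp.1 τ hτ i
      · exact col_mean p hp.1 τ hτ j)
    simpa using this
  have hS : ∀ S : Fin s → Fin n × Fin m,
      ES s (fun ε => ⨆ x, ∑ t, sgn (ε t) * (hind p τ (S t) * X x (S t).1 (S t).2)) ≤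
      Real.sqrt r * Real.sqrt (6 * k * v S) := by
    intro S
    have := cond_rad (cwt p τ) S (v S) (hv0 S) (fun i => hle S (Sum.inl i)) (fun j => hle S (Sum.inr j))
      k hk hN (fun x => Matrix.diagonal (fun i => Real.sqrt (rowMarg p i)) * X x *
        Matrix.diagonal (fun j => Real.sqrt (colMarg p j))) (Real.sqrt r) hX
    refine le_trans (le_of_eq ?_) this
    congr 1; ext ε; congr 1; ext x
    refine Finset.sum_congr rfl fun t _ => ?_
    congr 1
    rw [mul_diagonal, diagonal_mul]
    unfold hind cwt
    split_ifs with h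
    · have a1 := Real.sqrt_pos.2 (hτ.trans_le h.1)
      have a2 := Real.sqrt_pos.2 (hτ.trans_le h.2)
      field_simp
    · simp
  refine (EX_mono hw hS).trans ?_
  rw [EX_const_mul]
  refine mul_le_mul_of_nonneg_left ?_ (Real.sqrt_nonneg _)
  refine Real.le_sqrt_of_sq_le ?_
  refine (EX_pow_le hw h1 _ (fun S => Real.sqrt_nonneg _) 2).trans ?_
  have : ∀ S, Real.sqrt (6 * k * v S) ^ 2 = 6 * k * v S := fun S =>
    Real.sq_sqrt (mul_nonneg (by positivity) (hv0 S))
  simp only [this]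
  rw [EX_const_mul]
  exact mul_le_mul_of_nonneg_left hEv (by positivity)
end

set_option maxHeartbeats 1000000 in
theorem main_heavy {n m s : ℕ} (r l b δ : ℝ) (p : Matrix (Fin n) (Fin m) ℝ)
    (ℓ : ℝ → ℝ → ℝ) (Y : Matrix (Fin n) (Fin m) ℝ)
    (Xhat : (Fin s → Fin n × Fin m) → Matrix (Fin n) (Fin m) ℝ)
    (hm : 2 ≤ m) (hmn : m ≤ n) (hr : 1 ≤ r) (hl : 0 ≤ l) (hb : 0 ≤ b) (hs : 1 ≤ s)
    (hp : IsDistrib p) (hℓ : LipLoss l ℓ) (hB : ∀ x y, 0 ≤ ℓ x y ∧ ℓ x y ≤ b)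
    (hX : ∀ S, Xhat S ∈ Wball (rowMarg p) (colMarg p) r) (hδ0 : 0 < δ) (hδ1 : δ ≤ 1)
    (hδ : r * n * Real.log n = s * δ ^ 3) :
    EX (pw p) s (fun S => popRisk p ℓ Y (Xhat S) - empRisk ℓ Y S (Xhat S)) ≤ 20 * (l + b) * δ := by
  have hn2 : (2 : ℝ) ≤ n := by exact_mod_cast hm.trans hmn
  have hmn' : (m : ℝ) ≤ n := by exact_mod_cast hmn
  have hm2 : (2 : ℝ) ≤ m := by exact_mod_cast hm
  have hn0 : (0 : ℝ) < n := by linarith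
  have hs0 : (0 : ℝ) < s := by exact_mod_cast hs
  have hw : ∀ a, 0 ≤ pw p a := fun a => hp.1 _ _
  have h1 := pw_sum p hp
  have : Nonempty (Fin s → Fin n × Fin m) := ⟨fun _ => (⟨0, by omega⟩, ⟨0, by omega⟩)⟩
  set τ := δ / n with hτ
  have hτ0 : 0 < τ := by positivity
  set φ : (Fin s → Fin n × Fin m) → Fin n × Fin m → ℝ :=
    fun x a => hind p τ a * ℓ (Xhat x a.1 a.2) (Y a.1 a.2) with hφ
  have hh : ∀ a, hind p τ a = 0 ∨ hind p τ a = 1 := by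
    intro a; unfold hind; split_ifs <;> simp
  -- pointwise bound
  have pt : ∀ S, popRisk p ℓ Y (Xhat S) - empRisk ℓ Y S (Xhat S) ≤
      2 * b * δ + 1 / s * ⨆ x, (s * ∑ a, pw p a * φ x a - ∑ t, φ x (S t)) := by
    intro S
    have a1 := le_ciSup (f := fun x => (s * ∑ a, pw p a * φ x a - ∑ t, φ x (S t)))
      (Set.finite_range _).bddAbove S
    have a2 := mul_le_mul_of_nonneg_left a1 (by positivity : 0 ≤ 1 / (s : ℝ))
    refine le_trans ?_ (add_le_add le_rfl a2)
    have a3 : popRisk p ℓ Y (Xhat S) ≤ 2 * b * δ + ∑ a, pw p a * φ S a := by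
      have e : popRisk p ℓ Y (Xhat S) = ∑ a, pw p a * ℓ (Xhat S a.1 a.2) (Y a.1 a.2) := by
        rw [Fintype.sum_prod_type]; rfl
      have lp := light_prob p hp τ hτ0
      have lp2 : ((n : ℝ) + m) * τ ≤ 2 * δ := by
        have : (n : ℝ) * τ = δ := by rw [hτ]; field_simp
        have := mul_le_mul_of_nonneg_right hmn' hτ0.le
        linarith
      have lp3 := mul_le_mul_of_nonneg_left (lp.trans lp2) hb
      have : popRisk p ℓ Y (Xhat S) ≤ b * ∑ a, pw p a * (1 - hind p τ a) + ∑ a, pw p a * φ S a := by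
        rw [e, Finset.mul_sum, ← Finset.sum_add_distrib]
        refine Finset.sum_le_sum fun a _ => ?_
        have := mul_le_mul_of_nonneg_left (hB (Xhat S a.1 a.2) (Y a.1 a.2)).2 (hw a)
        rcases hh a with h | h <;> simp only [hφ, h] <;> nlinarith
      linarith
    have a4 : 1 / (s : ℝ) * ∑ t, φ S (S t) ≤ empRisk ℓ Y S (Xhat S) := by
      unfold empRisk
      refine mul_le_mul_of_nonneg_left (Finset.sum_le_sum fun t _ => ?_) (by positivity)
      have := (hB (Xhat S (S t).1 (S t).2) (Y (S t).1 (S t).2)).1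
      rcases hh (S t) with h | h <;> simp only [hφ, h] <;> linarith
    have a5 : 1 / (s : ℝ) * (s * ∑ a, pw p a * φ S a - ∑ t, φ S (S t)) =
        ∑ a, pw p a * φ S a - 1 / (s : ℝ) * ∑ t, φ S (S t) := by field_simp
    simp only [a5]
    linarith
  refine (EX_mono hw pt).trans ?_
  rw [EX_add, EX_const h1, EX_const_mul]
  have sy := symmetrization (s := s) hw h1 φ
  -- contraction
  have ct : ∀ S : Fin s → Fin n × Fin m, ES s (fun ε => ⨆ x, ∑ t, sgn (ε t) * φ x (S t)) ≤
      l * ES s (fun ε => ⨆ x, ∑ t, sgn (ε t) * (hind p τ (S t) * Xhat x (S t).1 (S t).2)) := by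
    intro S
    refine (contraction (fun t x => φ x (S t))
      (fun t x => l * (hind p τ (S t) * Xhat x (S t).1 (S t).2)) ?_).trans (le_of_eq ?_)
    · intro t x y
      change |hind p τ (S t) * ℓ (Xhat x (S t).1 (S t).2) (Y (S t).1 (S t).2) -
        hind p τ (S t) * ℓ (Xhat y (S t).1 (S t).2) (Y (S t).1 (S t).2)| ≤
        |l * (hind p τ (S t) * Xhat x (S t).1 (S t).2) - l * (hind p τ (S t) * Xhat y (S t).1 (S t).2)|
      rw [← mul_sub, ← mul_sub, ← mul_sub, abs_mul, abs_mul, abs_mul, abs_of_nonneg hl, mul_left_comm]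
      exact mul_le_mul_of_nonneg_left (hℓ _ _ _) (abs_nonneg _)
    · unfold ES
      rw [← EX_const_mul]
      congr 1; ext ε
      rw [Real.mul_iSup_of_nonneg hl]
      congr 1; ext x
      rw [Finset.mul_sum]
      exact Finset.sum_congr rfl fun t _ => by ring
  have ct2 := EX_mono hw ct
  rw [EX_const_mul] at ct2
  set k := ⌈Real.log (2 * n)⌉₊ with hk
  have hlog2 : 0.69 < Real.log 2 := by have := Real.log_two_gt_d9; linarith
  have hLN : Real.log 2 ≤ Real.log n := Real.log_le_log (by norm_num) hn2
  have hl2n : Real.log (2 * n) = Real.log 2 + Real.log n :=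
    Real.log_mul (by norm_num) hn0.ne'
  have hk0 : k ≠ 0 := by
    have : 0 < k := Nat.ceil_pos.2 (by linarith)
    omega
  have hk1 : (k : ℝ) ≤ 4 * Real.log n := by
    have := Nat.ceil_lt_add_one (a := Real.log (2 * n)) (by linarith)
    rw [← hk] at this
    linarith
  have hN : (n : ℝ) + m ≤ 3 ^ k := by
    have c1 : Real.log (2 * n) ≤ k := Nat.le_ceil _
    have c2 : (2 : ℝ) * n ≤ Real.exp k := by
      rw [← Real.log_le_iff_le_exp (by positivity)]; exact c1
    have c3 : Real.exp k ≤ 3 ^ k := by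
      rw [← mul_one (k : ℝ), Real.exp_nat_mul]
      exact pow_le_pow_left₀ (Real.exp_pos _).le (by have := Real.exp_one_lt_d9; linarith) k
    linarith
  have rb := rad_bound (s := s) p hp τ hτ0 r (by omega) k hk0 hN Xhat hX
  have fin : Real.sqrt r * Real.sqrt (6 * k * (1 / τ ^ 2 * Real.log (n + m) + 2 * s * (1 / τ))) ≤
      10 * (s * δ) := by
    rw [← Real.sqrt_mul (by linarith)]
    refine Real.sqrt_le_iff.2 ⟨by positivity, ?_⟩
    have hlognm : Real.log (n + m) ≤ 2 * Real.log n := by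
      have : Real.log (n + m) ≤ Real.log (2 * n) := Real.log_le_log (by linarith) (by linarith)
      linarith
    have hL0 : 0 < Real.log n := by linarith
    have hnm0 : 0 ≤ Real.log (n + m) := Real.log_nonneg (by linarith)
    have q1 : n * Real.log n ≤ s * δ := by
      have u1 : n * Real.log n ≤ r * n * Real.log n := by
        have : 0 < n * Real.log n := by positivity
        nlinarith
      have u2 : δ ^ 3 ≤ δ := by
        have : δ ^ 2 ≤ 1 := by nlinarith
        nlinarith
      have := mul_le_mul_of_nonneg_left u2 hs0.le
      linarith
    calc r * (6 * k * (1 / τ ^ 2 * Real.log (n + m) + 2 * s * (1 / τ)))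
        ≤ r * (6 * (4 * Real.log n) * (1 / τ ^ 2 * (2 * Real.log n) + 2 * s * (1 / τ))) := by
          gcongr
      _ = 48 * (r * n * Real.log n) * (n * Real.log n + s * δ) / δ ^ 2 := by
          rw [hτ]; field_simp; ring
      _ = 48 * (s * δ) * (n * Real.log n + s * δ) := by
          rw [hδ]; field_simp
      _ ≤ 48 * (s * δ) * (s * δ + s * δ) := by gcongr
      _ ≤ (10 * (s * δ)) ^ 2 := by nlinarith [sq_nonneg (s * δ)]
  have tot : EX (pw p) s (fun S => ⨆ x, (s * ∑ a, pw p a * φ x a - ∑ t, φ x (S t))) ≤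
      2 * (l * (10 * (s * δ))) := by
    refine sy.trans (mul_le_mul_of_nonneg_left (ct2.trans ?_) (by norm_num))
    exact mul_le_mul_of_nonneg_left (rb.trans fin) hl
  have tot2 := mul_le_mul_of_nonneg_left tot (by positivity : 0 ≤ 1 / (s : ℝ))
  have e : 1 / (s : ℝ) * (2 * (l * (10 * (s * δ)))) = 20 * l * δ := by field_simp; ring
  rw [e] at tot2
  have : 0 ≤ b * δ := by positivity
  nlinarith

/-- Theorem 2: for an arbitrary sampling distribution and an `l`-Lipschitz
loss bounded by `b`, any empirical risk minimizer over the `p`-weighted trace-norm ball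
satisfies `E_S[L_p(X̂_S)] ≤ inf_{X ∈ W_p} L_p(X) + C·(l+b)·(r n log n / s)^{1/3}`. -/
theorem weighted_traceNorm_bounded_loss_cubeRoot :
    ∃ C : ℝ, 0 < C ∧
      ∀ (n m s : ℕ) (r l b : ℝ) (p : Matrix (Fin n) (Fin m) ℝ)
        (ℓ : ℝ → ℝ → ℝ) (Y : Matrix (Fin n) (Fin m) ℝ)
        (Xhat : (Fin s → Fin n × Fin m) → Matrix (Fin n) (Fin m) ℝ),
        2 ≤ m → m ≤ n → 1 ≤ r → 0 ≤ l → 0 ≤ b → 1 ≤ s →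
        IsDistrib p →
        LipLoss l ℓ →
        (∀ x y, 0 ≤ ℓ x y ∧ ℓ x y ≤ b) →
        (∀ S, Xhat S ∈ Wball (rowMarg p) (colMarg p) r ∧
          ∀ X ∈ Wball (rowMarg p) (colMarg p) r,
            empRisk ℓ Y S (Xhat S) ≤ empRisk ℓ Y S X) →
        Esample s p (fun S => popRisk p ℓ Y (Xhat S)) ≤
          sInf ((fun X => popRisk p ℓ Y X) '' Wball (rowMarg p) (colMarg p) r) +
            C * (l + b) * (r * n * Real.log n / s) ^ ((1 : ℝ) / 3) := by
  refine ⟨20, by norm_num, ?_⟩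
  intro n m s r l b p ℓ Y Xhat hm hmn hr hl hb hs hp hℓ hB hX
  have hn2 : (2 : ℝ) ≤ n := by exact_mod_cast hm.trans hmn
  have hn0 : (0 : ℝ) < n := by linarith
  have hs0 : (0 : ℝ) < s := by exact_mod_cast hs
  have hlog : 0 < Real.log n := Real.log_pos (by linarith)
  have hw : ∀ a, 0 ≤ pw p a := fun a => hp.1 _ _
  have h1 := pw_sum p hp
  have hK : 0 < r * n * Real.log n / s := by positivity
  set δ := (r * n * Real.log n / s) ^ ((1 : ℝ) / 3) with hδ
  have hδ0 : 0 < δ := Real.rpow_pos_of_pos hK _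
  have hδ3 : δ ^ 3 = r * n * Real.log n / s := by
    rw [hδ, ← Real.rpow_natCast, ← Real.rpow_mul hK.le]
    norm_num
  have hE : ∀ f : (Fin s → Fin n × Fin m) → ℝ, Esample s p f = EX (pw p) s f := by
    intro f
    unfold Esample EX sampleProb pw
    refine Finset.sum_congr ?_ fun S _ => rfl
    ext; simp
  have epop : ∀ X, popRisk p ℓ Y X = ∑ a, pw p a * ℓ (X a.1 a.2) (Y a.1 a.2) := by
    intro X
    rw [Fintype.sum_prod_type]; rfl
  have hpop0 : ∀ X, 0 ≤ popRisk p ℓ Y X := by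
    intro X; rw [epop]
    exact Finset.sum_nonneg fun a _ => mul_nonneg (hw a) (hB _ _).1
  have hpopb : ∀ X, popRisk p ℓ Y X ≤ b := by
    intro X; rw [epop]
    calc ∑ a, pw p a * ℓ (X a.1 a.2) (Y a.1 a.2) ≤ ∑ a, pw p a * b :=
          Finset.sum_le_sum fun a _ => mul_le_mul_of_nonneg_left (hB _ _).2 (hw a)
      _ = b := by rw [← Finset.sum_mul, h1, one_mul]
  have hne : (Wball (rowMarg p) (colMarg p) r).Nonempty :=
    ⟨_, (hX (fun _ => (⟨0, by omega⟩, ⟨0, by omega⟩))).1⟩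
  rw [hE, ← sub_le_iff_le_add]
  refine le_csInf (hne.image _) ?_
  rintro _ ⟨X, hXW, rfl⟩
  simp only
  rw [sub_le_iff_le_add]
  rcases le_total δ 1 with hd | hd
  · have mh := main_heavy r l b δ p ℓ Y Xhat hm hmn hr hl hb hs hp hℓ hB (fun S => (hX S).1) hδ0 hd
      (by rw [hδ3]; field_simp)
    rw [EX_sub] at mh
    have e2 : EX (pw p) s (fun S => empRisk ℓ Y S (Xhat S)) ≤ popRisk p ℓ Y X := by
      refine (EX_mono hw fun S => (hX S).2 X hXW).trans (le_of_eq ?_)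
      unfold empRisk
      rw [EX_const_mul, EX_evalsum h1 (fun a => ℓ (X a.1 a.2) (Y a.1 a.2)), epop]
      field_simp
    linarith
  · have e3 : EX (pw p) s (fun S => popRisk p ℓ Y (Xhat S)) ≤ b := by
      refine (EX_mono hw fun S => hpopb (Xhat S)).trans (le_of_eq ?_)
      exact EX_const h1 b
    have := hpop0 X
    have h5 : b ≤ 20 * (l + b) * δ := by nlinarith
    linarith

end
end

section
/- (Lower bound for arbitrary distributions with bounded loss.) Let n = m be even, let s ≤ n·m, suppose a = (2s/n)^{2/3} is an integer with a < n, and take the loss ℓ(x,y) = min{1, |x−y|} and r = 1. Define Y ∈ ℝ^{n×n} to have an arbitrary ±1-valued a×(n/2) block A in the top-left corner and zeros elsewhere, and define the distribution p by p(i,j) = 1/(2s) on the support of the block A, p(i,j) = (1 − an/(4s))/((n−a)·n/2) on the bottom-right (n−a)×(n/2) block, and p(i,j) = 0 elsewhere. Then: (i) ‖Y‖_tr(p) ≤ 1, so inf_{X∈W_p} L_p(X) = 0; (ii) for a sample S of size s drawn i.i.d. from p, the matrix Y^S defined by Y^S_{ij} = Y_{ij}·1{(i,j) ∈ S} satisfies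 ‖Y^S‖_tr(p) ≤ 1 and L̂_S(Y^S) = 0 (so Y^S is an empirical risk minimizer over W_p); and (iii) E_S[L_p(Y^S)] ≥ (1/8)·(n/s)^{1/3}. -/
open scoped Classical
open Matrix Finset

noncomputable section

-- HELPERS
lemma tn_le {n : ℕ} (a h : ℕ) (han : a ≤ n) (hhn : h ≤ n) (c : ℝ)
    (X : Matrix (Fin n) (Fin n) ℝ)
    (hX : ∀ i j : Fin n, (X i j) ^ 2 ≤ if (i : ℕ) < a ∧ (j : ℕ) < h then c else 0) :
    traceNorm X ≤ Real.sqrt (a * (a * h * c)) := by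
  have hH := Matrix.isHermitian_conjTranspose_mul_self X
  have hnn : ∀ j, 0 ≤ hH.eigenvalues j :=
    (Matrix.posSemidef_conjTranspose_mul_self X).eigenvalues_nonneg
  have hca : (Finset.univ.filter (fun i : Fin n => (i : ℕ) < a)).card = a := by
    rw [Fin.card_filter_val_lt]; exact min_eq_right han
  have hch : (Finset.univ.filter (fun i : Fin n => (i : ℕ) < h)).card = h := by
    rw [Fin.card_filter_val_lt]; exact min_eq_right hhn
  have htr : ∑ j, hH.eigenvalues j = ∑ j, ∑ i, (X i j) ^ 2 := by
    have h1 := hH.trace_eq_sum_eigenvalues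
    simp only [RCLike.ofReal_real_eq_id, id] at h1
    rw [← h1]
    simp [Matrix.trace, Matrix.mul_apply, sq]
  have htr2 : ∑ j, hH.eigenvalues j ≤ a * h * c := by
    rw [htr]
    calc _ ≤ ∑ j : Fin n, ∑ i : Fin n, (if (i : ℕ) < a ∧ (j : ℕ) < h then c else 0) :=
          Finset.sum_le_sum fun j _ => Finset.sum_le_sum fun i _ => hX i j
      _ = ∑ j : Fin n, (if (j : ℕ) < h then (a : ℝ) * c else 0) := by
          refine Finset.sum_congr rfl fun j _ => ?_
          by_cases hj : (j : ℕ) < h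
          · simp only [hj, and_true, if_true]
            rw [← Finset.sum_filter, Finset.sum_const, hca, nsmul_eq_mul]
          · simp [hj]
      _ = a * h * c := by
          rw [← Finset.sum_filter, Finset.sum_const, hch, nsmul_eq_mul]; ring
  have hrank : (Xᴴ * X).rank ≤ a := by
    refine (Matrix.rank_mul_le_right _ _).trans ?_
    have hD : X = Matrix.diagonal (fun i : Fin n => if (i : ℕ) < a then (1 : ℝ) else 0) * X := by
      ext i j
      rw [Matrix.diagonal_mul]
      by_cases hi : (i : ℕ) < a
      · simp [hi]
      · have := hX i j
        simp only [hi, false_and, if_false] at this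
        have : X i j = 0 := by nlinarith [sq_nonneg (X i j)]
        simp [this]
    rw [hD]
    refine (Matrix.rank_mul_le_left _ _).trans ?_
    rw [Matrix.rank_diagonal]
    rw [Fintype.card_subtype]
    refine le_of_eq ?_
    refine Eq.trans ?_ hca
    congr 1
    ext i
    simp
  rw [hH.rank_eq_card_non_zero_eigs, Fintype.card_subtype] at hrank
  unfold traceNorm
  apply Real.le_sqrt_of_sq_le
  have e : ∑ j, Real.sqrt (hH.eigenvalues j) =
      ∑ j ∈ Finset.univ.filter (fun j => hH.eigenvalues j ≠ 0), Real.sqrt (hH.eigenvalues j) := by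
    rw [Finset.sum_filter]
    refine Finset.sum_congr rfl fun j _ => ?_
    by_cases hj : hH.eigenvalues j = 0
    · rw [if_neg (not_not.mpr hj), hj, Real.sqrt_zero]
    · rw [if_pos hj]
  rw [e]
  refine (sq_sum_le_card_mul_sum_sq).trans ?_
  have e2 : ∑ j ∈ Finset.univ.filter (fun j => hH.eigenvalues j ≠ 0),
      Real.sqrt (hH.eigenvalues j) ^ 2 ≤ a * h * c := by
    refine le_trans ?_ htr2
    refine (Finset.sum_le_sum_of_subset_of_nonneg (Finset.filter_subset _ _)
      (fun _ _ _ => sq_nonneg _)).trans ?_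
    exact Finset.sum_le_sum fun j _ => (Real.sq_sqrt (hnn j)).le
  refine mul_le_mul ?_ e2 (Finset.sum_nonneg fun _ _ => sq_nonneg _) (by positivity)
  exact_mod_cast hrank

lemma prob_miss {n s : ℕ} (p : Matrix (Fin n) (Fin n) ℝ)
    (hsum : ∑ i, ∑ j, p i j = 1) (i j : Fin n) :
    ∑ S : Fin s → Fin n × Fin n, sampleProb p S * (if ∃ t, S t = (i, j) then 0 else 1)
      = (1 - p i j) ^ s := by
  have h1 : (1 - p i j) = ∑ x : Fin n × Fin n, p x.1 x.2 * (if x = (i, j) then 0 else 1) := by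
    have hs2 : ∑ x : Fin n × Fin n, p x.1 x.2 = 1 := by
      rw [Fintype.sum_prod_type]; exact hsum
    rw [show p i j = ∑ x : Fin n × Fin n, (if x = (i, j) then p x.1 x.2 else 0) by simp]
    nth_rewrite 1 [← hs2]
    rw [← Finset.sum_sub_distrib]
    refine Finset.sum_congr rfl fun x _ => ?_
    split_ifs <;> simp
  rw [h1, Fintype.sum_pow]
  refine Finset.sum_congr rfl fun S _ => ?_
  rw [Finset.prod_mul_distrib]
  unfold sampleProb
  congr 1
  by_cases hS : ∃ t, S t = (i, j)
  · rw [if_pos hS]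
    obtain ⟨t, ht⟩ := hS
    exact (Finset.prod_eq_zero (Finset.mem_univ t) (by simp [ht])).symm
  · rw [if_neg hS]
    push Not at hS
    simp [hS]


/-- Example 1: lower bound for arbitrary distributions with bounded loss.
With `n = m` even, `a = (2s/n)^{2/3}` an integer, loss `ℓ(x,y) = min{1, |x−y|}`, `r = 1`,
target `Y` equal to a `±1` block `A` of size `a × (n/2)` in the top-left corner and zero
elsewhere, and `p` the described block-wise constant distribution:
(i) `‖Y‖_tr(p) ≤ 1` and `inf_{X ∈ W_p} L_p(X) = 0`;
(ii) the zeroed-out matrix `Y^S` is in `W_p` and has zero empirical risk (it is an ERM);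
(iii) `E_S[L_p(Y^S)] ≥ (1/8)·(n/s)^{1/3}`. -/
theorem lower_bound_bounded_loss_example
    (n s a : ℕ) (hn : Even n) (hn2 : 2 ≤ n) (hs : 1 ≤ s) (hsn : s ≤ n * n)
    (ha1 : 1 ≤ a) (han : a < n)
    (haval : (a : ℝ) = ((2 * (s : ℝ)) / n) ^ ((2 : ℝ) / 3))
    (A : Fin n → Fin n → ℝ)
    (hA : ∀ i j : Fin n, (i : ℕ) < a → (j : ℕ) < n / 2 → A i j = 1 ∨ A i j = -1)
    (ℓ : ℝ → ℝ → ℝ) (hℓ : ∀ x y, ℓ x y = min 1 |x - y|)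
    (Y p : Matrix (Fin n) (Fin n) ℝ)
    (hY : ∀ i j : Fin n, Y i j =
      if (i : ℕ) < a ∧ (j : ℕ) < n / 2 then A i j else 0)
    (hp : ∀ i j : Fin n, p i j =
      if (i : ℕ) < a ∧ (j : ℕ) < n / 2 then 1 / (2 * (s : ℝ))
      else if a ≤ (i : ℕ) ∧ n / 2 ≤ (j : ℕ) then
        (1 - (a : ℝ) * n / (4 * s)) / (((n : ℝ) - a) * ((n / 2 : ℕ) : ℝ))
      else 0) :
    (wTrNorm (rowMarg p) (colMarg p) Y ≤ 1 ∧
      sInf ((fun X => popRisk p ℓ Y X) '' Wball (rowMarg p) (colMarg p) 1) = 0) ∧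
    (∀ S : Fin s → Fin n × Fin n,
      wTrNorm (rowMarg p) (colMarg p)
          (fun i j => if ∃ t, S t = (i, j) then Y i j else 0) ≤ 1 ∧
      empRisk ℓ Y S (fun i j => if ∃ t, S t = (i, j) then Y i j else 0) = 0) ∧
    (1 / 8 : ℝ) * ((n : ℝ) / s) ^ ((1 : ℝ) / 3) ≤
      Esample s p (fun S =>
        popRisk p ℓ Y (fun i j => if ∃ t, S t = (i, j) then Y i j else 0)) := by
  obtain ⟨h, rfl⟩ : ∃ h, n = 2 * h := by obtain ⟨h, hh⟩ := hn; exact ⟨h, by omega⟩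
  have hdiv : 2 * h / 2 = h := by omega
  rw [hdiv] at hp
  rw [hdiv] at hA
  simp only [hdiv] at hY
  have hh : 1 ≤ h := by omega
  have hhR : (0 : ℝ) < h := by exact_mod_cast hh
  have hsR : (1 : ℝ) ≤ s := by exact_mod_cast hs
  have hsR0 : (0 : ℝ) < s := by linarith
  have haR : (1 : ℝ) ≤ a := by exact_mod_cast ha1
  have hanR : (a : ℝ) < 2 * h := by exact_mod_cast han
  push_cast at haval hp ⊢
  -- the cube root
  set u : ℝ := ((2 * (s : ℝ)) / (2 * h)) ^ ((1 : ℝ) / 3) with hu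
  have hu0 : 0 < u := by positivity
  have hu3 : u ^ 3 = s / h := by
    rw [hu, ← Real.rpow_natCast, ← Real.rpow_mul (by positivity)]
    norm_num
    field_simp
  have hau : (a : ℝ) = u ^ 2 := by
    rw [haval, hu, ← Real.rpow_natCast, ← Real.rpow_mul (by positivity)]
    norm_num
  have hu1 : 1 ≤ u := by nlinarith
  have hsu : (s : ℝ) = h * u ^ 3 := by rw [hu3]; field_simp
  have hmass : (a : ℝ) * (2 * h) / (4 * s) = 1 / (2 * u) := by
    rw [hsu, hau]; field_simp; norm_num
  rw [hmass] at hp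
  have hmass1 : 1 / (2 * u) ≤ 1 / 2 := by
    apply one_div_le_one_div_of_le <;> linarith
  set d : ℝ := (1 - 1 / (2 * u)) / ((2 * h - a) * h) with hd
  have hd0 : 0 ≤ d := by
    apply div_nonneg
    · linarith
    · apply mul_nonneg <;> linarith
  have hp0 : ∀ i j, 0 ≤ p i j := by
    intro i j
    rw [hp]
    split_ifs
    · positivity
    · exact hd0
    · exact le_rfl
  have hca : (Finset.univ.filter (fun i : Fin (2 * h) => (i : ℕ) < a)).card = a := by
    rw [Fin.card_filter_val_lt]; exact min_eq_right han.le
  have hch : (Finset.univ.filter (fun i : Fin (2 * h) => (i : ℕ) < h)).card = h := by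
    rw [Fin.card_filter_val_lt]; exact min_eq_right (by omega)
  have hsuma : ∀ x y : ℝ, ∑ i : Fin (2 * h), (if (i : ℕ) < a then x else y)
      = a * x + (2 * h - a) * y := by
    intro x y
    have : ∀ i : Fin (2 * h), (if (i : ℕ) < a then x else y)
        = (if (i : ℕ) < a then x - y else 0) + y := by
      intro i; split_ifs <;> ring
    rw [Finset.sum_congr rfl (fun i _ => this i), Finset.sum_add_distrib, ← Finset.sum_filter,
      Finset.sum_const, hca, nsmul_eq_mul]
    simp
    ring
  have hsumh : ∀ x y : ℝ, ∑ i : Fin (2 * h), (if (i : ℕ) < h then x else y)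
      = h * x + h * y := by
    intro x y
    have : ∀ i : Fin (2 * h), (if (i : ℕ) < h then x else y)
        = (if (i : ℕ) < h then x - y else 0) + y := by
      intro i; split_ifs <;> ring
    rw [Finset.sum_congr rfl (fun i _ => this i), Finset.sum_add_distrib, ← Finset.sum_filter,
      Finset.sum_const, hch, nsmul_eq_mul]
    simp
    ring
  have hrow : ∀ i, rowMarg p i = if (i : ℕ) < a then h * (1 / (2 * (s : ℝ))) else h * d := by
    intro i
    unfold rowMarg
    by_cases hi : (i : ℕ) < a
    · rw [if_pos hi]
      have := hsumh (1 / (2 * (s : ℝ))) 0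
      rw [mul_zero, add_zero] at this
      rw [← this]
      refine Finset.sum_congr rfl fun j _ => ?_
      rw [hp]
      simp [hi, not_le.mpr hi]
    · rw [if_neg hi]
      have := hsumh 0 d
      rw [mul_zero, zero_add] at this
      rw [← this]
      refine Finset.sum_congr rfl fun j _ => ?_
      rw [hp]
      by_cases hj : (j : ℕ) < h
      · simp [hi, hj, not_le.mpr hj]
      · simp [hi, hj, not_lt.mp hi, not_lt.mp hj]
  have hcol : ∀ j : Fin (2 * h), (j : ℕ) < h → colMarg p j = a * (1 / (2 * (s : ℝ))) := by
    intro j hj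
    unfold colMarg
    have := hsuma (1 / (2 * (s : ℝ))) 0
    rw [mul_zero, add_zero] at this
    rw [← this]
    refine Finset.sum_congr rfl fun i _ => ?_
    rw [hp]
    simp [hj, not_le.mpr hj]
  have hsum : ∑ i, ∑ j, p i j = 1 := by
    have : ∀ i, ∑ j, p i j = if (i : ℕ) < a then h * (1 / (2 * (s : ℝ))) else h * d := hrow
    rw [Finset.sum_congr rfl (fun i _ => this i), hsuma]
    have h1 : (2 * (h : ℝ) - a) * (h * d) = 1 - 1 / (2 * u) := by
      have : 2 * (h : ℝ) - a ≠ 0 := by linarith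
      rw [hd]; field_simp
    rw [h1, ← hmass]
    field_simp
    ring
  have hYsq : ∀ i j : Fin (2 * h), (i : ℕ) < a → (j : ℕ) < h → (Y i j) ^ 2 = 1 := by
    intro i j hi hj
    rw [hY, if_pos ⟨hi, hj⟩]
    rcases hA i j hi hj with h1 | h1 <;> rw [h1] <;> norm_num
  have hnorm : ∀ X : Matrix (Fin (2 * h)) (Fin (2 * h)) ℝ, (∀ i j, X i j = Y i j ∨ X i j = 0) →
      wTrNorm (rowMarg p) (colMarg p) X ≤ 1 := by
    intro X hX
    unfold wTrNorm
    refine (tn_le a h han.le (by omega)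
      ((h * (1 / (2 * (s : ℝ)))) * (a * (1 / (2 * (s : ℝ))))) _ ?_).trans ?_
    · intro i j
      rw [Matrix.mul_diagonal, Matrix.diagonal_mul]
      split_ifs with hij
      · rw [mul_pow, mul_pow, hrow, if_pos hij.1, hcol j hij.2, Real.sq_sqrt (by positivity),
          Real.sq_sqrt (by positivity)]
        have : X i j ^ 2 ≤ 1 := by
          rcases hX i j with h1 | h1 <;> rw [h1]
          · exact (hYsq i j hij.1 hij.2).le
          · norm_num
        have h2 : 0 ≤ (h * (1 / (2 * (s : ℝ)))) * (a * (1 / (2 * (s : ℝ)))) := by positivity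
        nlinarith
      · have : X i j = 0 := by
          rcases hX i j with h1 | h1
          · rw [h1, hY, if_neg hij]
          · exact h1
        rw [this]; simp
    · rw [Real.sqrt_le_one]
      rw [hsu, hau]
      have : u ^ 2 * (u ^ 2 * h * (h * (1 / (2 * (h * u ^ 3))) * (u ^ 2 * (1 / (2 * (h * u ^ 3))))))
        = 1 / 4 := by field_simp; norm_num
      rw [this]; norm_num
  have hYn : wTrNorm (rowMarg p) (colMarg p) Y ≤ 1 := hnorm Y fun _ _ => Or.inl rfl
  have hl0 : ∀ x y, 0 ≤ ℓ x y := by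
    intro x y; rw [hℓ]; exact le_min zero_le_one (abs_nonneg _)
  have hlself : ∀ x, ℓ x x = 0 := by intro x; rw [hℓ]; simp
  refine ⟨⟨hYn, ?_⟩, ?_, ?_⟩
  · refine IsLeast.csInf_eq ⟨⟨Y, ?_, ?_⟩, ?_⟩
    · show wTrNorm (rowMarg p) (colMarg p) Y ≤ Real.sqrt 1
      rw [Real.sqrt_one]; exact hYn
    · simp [popRisk, hlself]
    · rintro _ ⟨X, -, rfl⟩
      exact Finset.sum_nonneg fun i _ => Finset.sum_nonneg fun j _ => mul_nonneg (hp0 _ _) (hl0 _ _)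
  · intro S
    refine ⟨hnorm _ ?_, ?_⟩
    · intro i j
      by_cases hS : ∃ t, S t = (i, j)
      · left; exact if_pos hS
      · right; exact if_neg hS
    · unfold empRisk
      rw [Finset.sum_eq_zero, mul_zero]
      intro t _
      have : ∃ t', S t' = ((S t).1, (S t).2) := ⟨t, rfl⟩
      beta_reduce
      rw [if_pos this, hlself]
  · have hE : Esample s p (fun S =>
        popRisk p ℓ Y (fun i j => if ∃ t, S t = (i, j) then Y i j else 0))
        = ∑ i, ∑ j, (p i j * (if (i : ℕ) < a ∧ (j : ℕ) < h then 1 else 0)) * (1 - p i j) ^ s := by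
      unfold Esample popRisk
      simp_rw [Finset.mul_sum]
      rw [Finset.sum_comm]
      refine Finset.sum_congr rfl fun i _ => ?_
      rw [Finset.sum_comm]
      refine Finset.sum_congr rfl fun j _ => ?_
      rw [← prob_miss p hsum i j, Finset.mul_sum]
      refine Finset.sum_congr rfl fun S _ => ?_
      by_cases hS : ∃ t, S t = (i, j)
      · rw [if_pos hS, if_pos hS, hlself]; ring
      · rw [if_neg hS, if_neg hS]
        have : ℓ 0 (Y i j) = if (i : ℕ) < a ∧ (j : ℕ) < h then 1 else 0 := by
          rw [hℓ, hY]
          split_ifs with hij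
          · rcases hA i j hij.1 hij.2 with h1 | h1 <;> rw [h1] <;> norm_num
          · simp
        rw [this]; ring
    rw [hE]
    have hval : ∑ i, ∑ j, (p i j * (if (i : ℕ) < a ∧ (j : ℕ) < h then 1 else 0)) * (1 - p i j) ^ s
        = a * (h * (1 / (2 * (s : ℝ)) * (1 - 1 / (2 * (s : ℝ))) ^ s)) := by
      have := hsuma (h * (1 / (2 * (s : ℝ)) * (1 - 1 / (2 * (s : ℝ))) ^ s)) 0
      rw [mul_zero, add_zero] at this
      rw [← this]
      refine Finset.sum_congr rfl fun i _ => ?_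
      by_cases hi : (i : ℕ) < a
      · rw [if_pos hi]
        have := hsumh (1 / (2 * (s : ℝ)) * (1 - 1 / (2 * (s : ℝ))) ^ s) 0
        rw [mul_zero, add_zero] at this
        rw [← this]
        refine Finset.sum_congr rfl fun j _ => ?_
        by_cases hj : (j : ℕ) < h
        · rw [hp]; simp [hi, hj]
        · simp [hj]
      · simp [hi]
    rw [hval]
    have hbern : (1 : ℝ) / 2 ≤ (1 - 1 / (2 * (s : ℝ))) ^ s := by
      have hb : 1 / (2 * (s : ℝ)) ≤ 1 := by
        rw [div_le_one (by positivity)]; linarith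
      have := one_add_mul_le_pow (a := -(1 / (2 * (s : ℝ)))) (by linarith) s
      rw [← sub_eq_add_neg] at this
      refine le_trans (le_of_eq ?_) this
      field_simp; norm_num
    have hm2 : (a : ℝ) * h * (1 / (2 * (s : ℝ))) = 1 / (2 * u) := by
      rw [← hmass]; field_simp; norm_num
    have hfin : (2 * (h : ℝ) / s) ^ ((1 : ℝ) / 3) ≤ 2 * u⁻¹ := by
      have e1 : (2 * (h : ℝ) / s) = 8⁻¹ * 2 * (2 * u⁻¹) ^ 3 := by
        rw [hsu]; field_simp; norm_num
      have e2 : (2 * (h : ℝ) / s) ≤ (2 * u⁻¹) ^ 3 := by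
        rw [e1]
        have : 0 < (2 * u⁻¹) ^ 3 := by positivity
        linarith
      calc (2 * (h : ℝ) / s) ^ ((1 : ℝ) / 3) ≤ ((2 * u⁻¹) ^ 3) ^ ((1 : ℝ) / 3) :=
            Real.rpow_le_rpow (by positivity) e2 (by norm_num)
        _ = 2 * u⁻¹ := by
            rw [← Real.rpow_natCast, ← Real.rpow_mul (by positivity)]; norm_num
    have e3 : (a : ℝ) * (h * (1 / (2 * (s : ℝ)) * (1 - 1 / (2 * (s : ℝ))) ^ s))
        = (a : ℝ) * h * (1 / (2 * (s : ℝ))) * (1 - 1 / (2 * (s : ℝ))) ^ s := by ring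
    rw [e3, hm2]
    have h3 : 1 / (2 * u) * (1 / 2) ≤ 1 / (2 * u) * (1 - 1 / (2 * (s : ℝ))) ^ s :=
      mul_le_mul_of_nonneg_left hbern (by positivity)
    have h4 : 1 / (2 * u) * (1 / 2) = (1 / 8) * (2 * u⁻¹) := by field_simp; norm_num
    linarith

end
end

section
/- (Lower bound for arbitrary distributions with unbounded Lipschitz loss.) Let n = m, let 2 ≤ s ≤ n·m, take the loss ℓ(x,y) = |x−y| and r = 1, and let Y = 0 ∈ ℝ^{n×n}. Let p be any probability distribution on [n]×[n] with p(1,1) = 1/s and p(i,1) = p(1,j) = 0 for all i,j > 1 (so p^r(1) = p^c(1) = 1/s). Let A ∈ ℝ^{n×n} have A_{11} = s and zeros elsewhere; then ‖A‖_tr(p) = 1. For a sample S of size s drawn i.i.d. from p, with probability at least 1/4 the entry (1,1) does not appear in S; on this event, L̂_S(A) = 0 = min_{X∈W_p} L̂_S(X) (so A is an empirical risk minimizer over W_p) while L_p(A) = 1. Consequently there exists an empirical risk minimizer Ŷ_S over W_p with E_S[L_p(Ŷ_S)] ≥ 1/4. -/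
open scoped Classical
open Matrix Finset

noncomputable section

theorem aux_traceNorm {n : ℕ} (X : Matrix (Fin n) (Fin n) ℝ)
    (h : (Xᴴ * X) * (Xᴴ * X) = Xᴴ * X) : traceNorm X = (Xᴴ * X).trace := by
  unfold traceNorm
  have hH := Matrix.isHermitian_conjTranspose_mul_self X
  rw [hH.trace_eq_sum_eigenvalues]
  refine Finset.sum_congr rfl fun j _ => ?_
  have h1 := hH.mulVec_eigenvectorBasis j
  have h2 : (Xᴴ * X) *ᵥ ((Xᴴ * X) *ᵥ (hH.eigenvectorBasis j).ofLp) =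
      (Xᴴ * X) *ᵥ (hH.eigenvectorBasis j).ofLp := by
    rw [Matrix.mulVec_mulVec, h]
  rw [h1, Matrix.mulVec_smul, h1, smul_smul] at h2
  have hne : (hH.eigenvectorBasis j).ofLp ≠ 0 := by
    intro h0
    have := hH.eigenvectorBasis.orthonormal.ne_zero j
    apply this
    ext k
    exact congrFun h0 k
  have h3 := smul_left_injective ℝ hne h2
  have h4 : hH.eigenvalues j = 0 ∨ hH.eigenvalues j = 1 := by
    have h3' : hH.eigenvalues j * hH.eigenvalues j = hH.eigenvalues j := h3
    rcases eq_or_ne (hH.eigenvalues j) 0 with h | h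
    · exact Or.inl h
    · right
      exact mul_left_cancel₀ h (by rw [h3', mul_one])
  change √(hH.eigenvalues j) = hH.eigenvalues j
  rcases h4 with h | h <;> rw [h] <;> simp

theorem aux_pow (s : ℕ) (hs : 2 ≤ s) : (1 / 4 : ℝ) ≤ (1 - 1 / (s : ℝ)) ^ s := by
  have hs' : (2 : ℝ) ≤ s := by exact_mod_cast hs
  have hinv : 1 / (s : ℝ) ≤ 1 := by
    rw [div_le_one (by linarith)]; linarith
  have h := one_add_mul_self_le_rpow_one_add (s := -(1 / (s : ℝ))) (by linarith)
    (p := (s : ℝ) / 2) (by linarith)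
  have e : 1 + (s : ℝ) / 2 * -(1 / (s : ℝ)) = 1 / 2 := by
    field_simp; norm_num
  rw [e] at h
  have h0 : (0 : ℝ) ≤ 1 + -(1 / (s : ℝ)) := by linarith
  have e2 : (1 - 1 / (s : ℝ)) ^ s = ((1 + -(1 / (s : ℝ))) ^ ((s : ℝ) / 2)) ^ 2 := by
    rw [← Real.rpow_natCast _ 2, ← Real.rpow_mul h0, ← Real.rpow_natCast]
    congr 1
    push_cast
    ring
  rw [e2]
  nlinarith

/-- Example 2: lower bound for arbitrary distributions with unbounded
Lipschitz loss. With `ℓ(x,y) = |x−y|`, `r = 1`, `Y = 0`, and a distribution with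
`p(1,1) = 1/s` and the rest of the first row and column equal to zero:
the matrix `A` (with `A_{11} = s`) has `‖A‖_tr(p) = 1`; with probability at least `1/4` the
entry `(1,1)` is unobserved, in which case `A` is an ERM over `W_p`; `L_p(A) = 1`; and hence
some empirical risk minimizer `Ŷ_S` has `E_S[L_p(Ŷ_S)] ≥ 1/4`. -/
theorem lower_bound_unbounded_loss_example
    (n s : ℕ) [NeZero n] (hs : 2 ≤ s) (hsn : s ≤ n * n)
    (ℓ : ℝ → ℝ → ℝ) (hℓ : ∀ x y, ℓ x y = |x - y|)
    (p : Matrix (Fin n) (Fin n) ℝ) (hp : IsDistrib p)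
    (hp11 : p 0 0 = 1 / (s : ℝ))
    (hprow : ∀ i : Fin n, i ≠ 0 → p i 0 = 0)
    (hpcol : ∀ j : Fin n, j ≠ 0 → p 0 j = 0)
    (Y A : Matrix (Fin n) (Fin n) ℝ) (hY : Y = 0)
    (hA : ∀ i j : Fin n, A i j = if i = 0 ∧ j = 0 then (s : ℝ) else 0) :
    rowMarg p 0 = 1 / (s : ℝ) ∧ colMarg p 0 = 1 / (s : ℝ) ∧
    wTrNorm (rowMarg p) (colMarg p) A = 1 ∧
    (1 / 4 : ℝ) ≤ Esample s p
      (fun S => if ∀ t, S t ≠ ((0 : Fin n), (0 : Fin n)) then (1 : ℝ) else 0) ∧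
    (∀ S : Fin s → Fin n × Fin n, (∀ t, S t ≠ ((0 : Fin n), (0 : Fin n))) →
      empRisk ℓ Y S A = 0 ∧
      ∀ X ∈ Wball (rowMarg p) (colMarg p) 1, empRisk ℓ Y S A ≤ empRisk ℓ Y S X) ∧
    popRisk p ℓ Y A = 1 ∧
    (∃ Yhat : (Fin s → Fin n × Fin n) → Matrix (Fin n) (Fin n) ℝ,
      (∀ S, Yhat S ∈ Wball (rowMarg p) (colMarg p) 1 ∧
        ∀ X ∈ Wball (rowMarg p) (colMarg p) 1,
          empRisk ℓ Y S (Yhat S) ≤ empRisk ℓ Y S X) ∧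
      (1 / 4 : ℝ) ≤ Esample s p (fun S => popRisk p ℓ Y (Yhat S))) := by
  subst hY
  obtain ⟨hp0, hp1⟩ := hp
  have hspos : (0 : ℝ) < s := by exact_mod_cast (by omega : 0 < s)
  have hr : rowMarg p 0 = 1 / (s : ℝ) := by
    unfold rowMarg
    rw [Finset.sum_eq_single 0 (fun j _ hj => hpcol j hj) (by simp), hp11]
  have hc : colMarg p 0 = 1 / (s : ℝ) := by
    unfold colMarg
    rw [Finset.sum_eq_single 0 (fun j _ hj => hprow j hj) (by simp), hp11]
  have hAn : wTrNorm (rowMarg p) (colMarg p) A = 1 := by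
    have hE : Matrix.diagonal (fun i => Real.sqrt (rowMarg p i)) * A *
        Matrix.diagonal (fun j => Real.sqrt (colMarg p j)) =
        Matrix.diagonal (fun i : Fin n => if i = 0 then (1 : ℝ) else 0) := by
      ext i j
      rw [Matrix.mul_diagonal, Matrix.diagonal_mul, hA]
      by_cases hi : i = 0
      · by_cases hj : j = 0
        · subst hi; subst hj
          rw [hr, hc]
          simp only [and_self, if_true, Matrix.diagonal_apply_eq]
          rw [mul_right_comm, Real.mul_self_sqrt (by positivity)]
          field_simp
        · subst hi
          simp [hj, Matrix.diagonal_apply, Ne.symm hj]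
      · by_cases hij : i = j
        · subst hij; simp [hi]
        · simp [hi, hij]
    unfold wTrNorm
    rw [hE, aux_traceNorm]
    · simp [Matrix.diagonal_conjTranspose, Matrix.diagonal_mul_diagonal, Matrix.trace_diagonal]
    · simp [Matrix.diagonal_mul_diagonal]
      intro i
      split_ifs <;> rfl
  have h0n : wTrNorm (rowMarg p) (colMarg p) (0 : Matrix (Fin n) (Fin n) ℝ) = 0 := by
    unfold wTrNorm
    rw [aux_traceNorm] <;> simp
  have hprob : (1 / 4 : ℝ) ≤ Esample s p
      (fun S => if ∀ t, S t ≠ ((0 : Fin n), (0 : Fin n)) then (1 : ℝ) else 0) := by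
    have e : Esample s p
        (fun S => if ∀ t, S t ≠ ((0 : Fin n), (0 : Fin n)) then (1 : ℝ) else 0) =
        (1 - 1 / (s : ℝ)) ^ s := by
      have hq : ∑ q : Fin n × Fin n, (p q.1 q.2 * if q ≠ (0, 0) then (1 : ℝ) else 0) =
          1 - 1 / (s : ℝ) := by
        have e1 : ∀ q : Fin n × Fin n, (p q.1 q.2 * if q ≠ (0, 0) then (1 : ℝ) else 0) =
            p q.1 q.2 - if q = (0, 0) then p 0 0 else 0 := by
          intro q
          by_cases h : q = (0, 0)
          · subst h; simp
          · simp [h]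
        rw [Finset.sum_congr rfl fun q _ => e1 q, Finset.sum_sub_distrib,
          Fintype.sum_prod_type, hp1, Finset.sum_ite_eq' Finset.univ, hp11]
        simp
      rw [← hq, Fintype.sum_pow]
      unfold Esample sampleProb
      refine Finset.sum_congr rfl fun S _ => ?_
      rw [Finset.prod_mul_distrib]
      congr 1
      beta_reduce
      by_cases h : ∀ t, S t ≠ ((0 : Fin n), (0 : Fin n))
      · rw [if_pos h, Finset.prod_eq_one]
        intro t _
        rw [if_pos (h t)]
      · rw [if_neg h]
        push Not at h
        obtain ⟨t, ht⟩ := h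
        exact (Finset.prod_eq_zero (Finset.mem_univ t) (by simp [ht])).symm
    rw [e]
    exact aux_pow s hs
  have hnn : ∀ (S : Fin s → Fin n × Fin n) X, 0 ≤ empRisk ℓ 0 S X := by
    intro S X
    unfold empRisk
    refine mul_nonneg (by positivity) (Finset.sum_nonneg fun t _ => ?_)
    rw [hℓ]; exact abs_nonneg _
  have hE0 : ∀ S : Fin s → Fin n × Fin n, (∀ t, S t ≠ ((0 : Fin n), (0 : Fin n))) →
      empRisk ℓ 0 S A = 0 := by
    intro S hS
    unfold empRisk
    rw [Finset.sum_eq_zero, mul_zero]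
    intro t _
    have : ¬ ((S t).1 = 0 ∧ (S t).2 = 0) := fun h => hS t (Prod.ext h.1 h.2)
    rw [hℓ, hA, if_neg this]
    simp
  have hpop : popRisk p ℓ 0 A = 1 := by
    unfold popRisk
    rw [Finset.sum_eq_single 0, Finset.sum_eq_single 0]
    · rw [hℓ, hA, hp11]
      simp [hspos.ne']
    · intro j _ hj
      rw [hpcol j hj, zero_mul]
    · simp
    · intro i _ hi
      refine Finset.sum_eq_zero fun j _ => ?_
      rw [hℓ, hA]
      simp [hi]
    · simp
  refine ⟨hr, hc, hAn, hprob, fun S hS => ⟨hE0 S hS, fun X _ => ?_⟩, hpop, ?_⟩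
  · rw [hE0 S hS]; exact hnn S X
  refine ⟨fun S => if ∀ t, S t ≠ ((0 : Fin n), (0 : Fin n)) then A else 0, ?_, ?_⟩
  · intro S
    by_cases h : ∀ t, S t ≠ ((0 : Fin n), (0 : Fin n))
    · simp only [if_pos h]
      refine ⟨?_, fun X _ => by rw [hE0 S h]; exact hnn S X⟩
      change wTrNorm _ _ _ ≤ _
      rw [hAn]; simp
    · simp only [if_neg h]
      refine ⟨?_, fun X _ => ?_⟩
      · change wTrNorm _ _ _ ≤ _
        rw [h0n]; simp
      · have : empRisk ℓ 0 S (0 : Matrix (Fin n) (Fin n) ℝ) = 0 := by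
          unfold empRisk
          simp [hℓ]
        rw [this]; exact hnn S X
  · refine hprob.trans (le_of_eq ?_)
    congr 1
    funext S
    by_cases h : ∀ t, S t ≠ ((0 : Fin n), (0 : Fin n))
    · simp only [if_pos h, hpop]
    · simp only [if_neg h]
      unfold popRisk
      simp [hℓ]


end
end
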